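/- arXiv:1112.2351 — 2 statements merged into one kernel-verified Lean document; each statement's English description precedes it below -/
import Mathlib

section
/- Let p, r : [0,1] → ℝ be continuous with p(x) > 0 and r(x) > 0 for all x ∈ [0,1], let c < 0 and α ≤ 0, and let n ≥ 1. Suppose λ < 0 is an eigenvalue of the problem (E_T) with boundary conditions (BC2), suppose the set of eigenvalues μ of this problem with λ < μ < 0 has exactly n − 1 elements, and let y be a nontrivial classical solution at λ. Then the set {x ∈ (0,1) : y(x) = 0} has exactly n − 1 elements, and y'(a) ≠ 0 for every a ∈ (0,1) with y(a) = 0. -/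
open Set

/-- Derivative within the interval `[0,1]`. -/
noncomputable def Dv (y : ℝ → ℝ) : ℝ → ℝ := derivWithin y (Set.Icc 0 1)

/-- `y` is not identically zero on `[0,1]`. -/
def Nontriv (y : ℝ → ℝ) : Prop := ∃ x ∈ Set.Icc (0:ℝ) 1, y x ≠ 0

/-- `y` is a classical solution of `(p y'')'' - lam * (-y'' + c r y) = 0` on `[0,1]`. -/
def SolT (p r : ℝ → ℝ) (c lam : ℝ) (y : ℝ → ℝ) : Prop :=
  ContDiffOn ℝ 2 y (Set.Icc 0 1) ∧
  ContDiffOn ℝ 2 (fun x => p x * Dv (Dv y) x) (Set.Icc 0 1) ∧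
  ∀ x ∈ Set.Icc (0:ℝ) 1,
    Dv (Dv (fun t => p t * Dv (Dv y) t)) x
      - lam * (-(Dv (Dv y) x) + c * r x * y x) = 0

/-- Clamped boundary conditions `y(0) = y'(0) = y(1) = y'(1) = 0`. -/
def BC1 (y : ℝ → ℝ) : Prop := y 0 = 0 ∧ Dv y 0 = 0 ∧ y 1 = 0 ∧ Dv y 1 = 0

/-- Boundary conditions `y(0) = y'(0) = y'(1) = 0`, `(p y'')'(1) + lam * alpha * y(1) = 0`. -/
def BC2 (p : ℝ → ℝ) (lam alpha : ℝ) (y : ℝ → ℝ) : Prop :=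
  y 0 = 0 ∧ Dv y 0 = 0 ∧ Dv y 1 = 0 ∧
  Dv (fun t => p t * Dv (Dv y) t) 1 + lam * alpha * y 1 = 0

/-- Linear dependence of two functions on `[0,1]`. -/
def LinDep (y₁ y₂ : ℝ → ℝ) : Prop :=
  ∃ a b : ℝ, (a ≠ 0 ∨ b ≠ 0) ∧ ∀ x ∈ Set.Icc (0:ℝ) 1, a * y₁ x + b * y₂ x = 0

/-- `lam` is an eigenvalue of the problem (E_T), (BC2). -/
def EigT2 (p r : ℝ → ℝ) (c alpha lam : ℝ) : Prop :=
  ∃ y : ℝ → ℝ, SolT p r c lam y ∧ Nontriv y ∧ BC2 p lam alpha y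

section LinearODE

variable {E : Type*} [NormedAddCommGroup E] [NormedSpace ℝ E]

/-- Terms of the Picard series. -/
noncomputable def picTerm (A : ℝ → ℝ → E →L[ℝ] E) (z0 : E) : ℕ → ℝ → ℝ → E
  | 0 => fun _ _ => z0
  | k+1 => fun L x => ∫ t in (0:ℝ)..x, A L t (picTerm A z0 k L t)

lemma picTerm_cont (A : ℝ → ℝ → E →L[ℝ] E) (hA : Continuous (fun z : ℝ × ℝ => A z.1 z.2))
    (z0 : E) (k : ℕ) : Continuous (fun z : ℝ × ℝ => picTerm A z0 k z.1 z.2) := by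
  induction k with
  | zero => simpa [picTerm] using continuous_const
  | succ k ih =>
    have h : Continuous (fun z : ℝ × ℝ => A z.1 z.2 (picTerm A z0 k z.1 z.2)) := hA.clm_apply ih
    exact intervalIntegral.continuous_parametric_primitive_of_continuous
      (f := fun L t => A L t (picTerm A z0 k L t)) h

lemma picTerm_bound (A : ℝ → ℝ → E →L[ℝ] E) (hA : Continuous (fun z : ℝ × ℝ => A z.1 z.2))
    (z0 : E) (L K : ℝ) (hK : ∀ t, ‖A L t‖ ≤ K) (k : ℕ) (x : ℝ) :
    ‖picTerm A z0 k L x‖ ≤ (K * |x|) ^ k / k.factorial * ‖z0‖ := by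
  have hK0 : 0 ≤ K := (norm_nonneg _).trans (hK 0)
  induction k generalizing x with
  | zero => simp [picTerm]
  | succ n ih =>
    have hc : Continuous (fun t => A L t (picTerm A z0 n L t)) :=
      (hA.comp (by fun_prop : Continuous fun t : ℝ => (L, t))).clm_apply
        ((picTerm_cont A hA z0 n).comp (by fun_prop : Continuous fun t : ℝ => (L, t)))
    calc ‖picTerm A z0 (n+1) L x‖ 
      _ ≤ ∫ τ in uIoc 0 x, K ^ (n + 1) * |τ - 0| ^ n / n.factorial * ‖z0‖ := by
        rw [picTerm, intervalIntegral.norm_intervalIntegral_eq]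
        apply MeasureTheory.norm_integral_le_of_norm_le (Continuous.integrableOn_uIoc (by fun_prop))
        refine Filter.Eventually.of_forall fun t => ?_
        calc ‖A L t (picTerm A z0 n L t)‖ ≤ ‖A L t‖ * ‖picTerm A z0 n L t‖ :=
              (A L t).le_opNorm _
          _ ≤ K * ((K * |t|) ^ n / n.factorial * ‖z0‖) := by
              gcongr
              · exact hK t
              · exact ih t
          _ = _ := by rw [sub_zero]; ring
      _ ≤ (K * |x|) ^ (n + 1) / (n + 1).factorial * ‖z0‖ := by
        apply le_of_abs_le
        rw [← intervalIntegral.abs_intervalIntegral_eq, intervalIntegral.integral_mul_const,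
          intervalIntegral.integral_div, intervalIntegral.integral_const_mul, abs_mul, abs_div,
          abs_mul, intervalIntegral.abs_intervalIntegral_eq, integral_pow_abs_sub_uIoc, abs_div,
          abs_pow, abs_pow, abs_norm, abs_of_nonneg hK0, abs_abs, mul_div, div_div, 
          ← Nat.cast_succ, Nat.abs_cast, Nat.abs_cast, ← Nat.cast_mul, ← Nat.factorial_succ,
          sub_zero, ← mul_pow]

lemma linODE_exists [CompleteSpace E] (A : ℝ → ℝ → E →L[ℝ] E)
    (hA : Continuous (fun z : ℝ × ℝ => A z.1 z.2))
    (K : ℝ → ℝ) (hKc : Monotone K) (hK : ∀ L t, ‖A L t‖ ≤ K |L|) (z0 : E) :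
    ∃ Z : ℝ → ℝ → E, Continuous (fun z : ℝ × ℝ => Z z.1 z.2) ∧ (∀ L, Z L 0 = z0) ∧
      ∀ L x, HasDerivAt (Z L) (A L x (Z L x)) x := by
  have hK0 : ∀ s, 0 ≤ s → 0 ≤ K s := fun s hs => by
    have := (norm_nonneg _).trans (hK s 0); rwa [abs_of_nonneg hs] at this
  have hsum : ∀ C, Summable (fun k : ℕ => C ^ k / k.factorial * ‖z0‖) := fun C =>
    (Real.summable_pow_div_factorial C).mul_right _
  have hb : ∀ S L x, |L| ≤ S → |x| ≤ S → ∀ k, ‖picTerm A z0 k L x‖ ≤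
      (K S * S) ^ k / k.factorial * ‖z0‖ := by
    intro S L x hL hx k
    refine (picTerm_bound A hA z0 L (K |L|) (hK L) k x).trans ?_
    have h1 : K |L| ≤ K S := hKc hL
    have h2 := hK0 |L| (abs_nonneg _)
    have h3 := h2.trans h1
    gcongr
  have hsm : ∀ L x, Summable (fun k => picTerm A z0 k L x) := fun L x =>
    Summable.of_norm_bounded (hsum _) (hb (max |L| |x|) L x (le_max_left _ _) (le_max_right _ _))
  refine ⟨fun L x => ∑' k, picTerm A z0 k L x, ?_, ?_, ?_⟩
  · rw [continuous_iff_continuousAt]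
    intro z
    set S := max |z.1| |z.2| + 1
    have ho : {w : ℝ × ℝ | |w.1| < S ∧ |w.2| < S} ∈ nhds z := by
      refine IsOpen.mem_nhds ?_ ⟨?_, ?_⟩
      · have h1 : IsOpen {w : ℝ × ℝ | |w.1| < S} := isOpen_lt (by fun_prop) (by fun_prop)
        have h2 : IsOpen {w : ℝ × ℝ | |w.2| < S} := isOpen_lt (by fun_prop) (by fun_prop)
        exact h1.inter h2
      · exact (le_max_left _ _).trans_lt (lt_add_one _)
      · exact (le_max_right _ _).trans_lt (lt_add_one _)
    refine ContinuousOn.continuousAt ?_ ho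
    exact continuousOn_tsum (fun k => (picTerm_cont A hA z0 k).continuousOn) (hsum _)
      (fun k w hw => hb S w.1 w.2 hw.1.le hw.2.le k)
  · intro L
    change ∑' k, picTerm A z0 k L 0 = z0
    rw [tsum_eq_single 0]
    · simp [picTerm]
    · intro k hk
      obtain ⟨j, rfl⟩ := Nat.exists_eq_succ_of_ne_zero hk
      simp [picTerm]
  · intro L x
    have hcA : ∀ k, Continuous (fun t => A L t (picTerm A z0 k L t)) := fun k =>
      (hA.comp (by fun_prop : Continuous fun t : ℝ => (L, t))).clm_apply
        ((picTerm_cont A hA z0 k).comp (by fun_prop : Continuous fun t : ℝ => (L, t)))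
    have hd : ∀ k y, HasDerivAt (picTerm A z0 (k+1) L) (A L y (picTerm A z0 k L y)) y := fun k y =>
      intervalIntegral.integral_hasDerivAt_right ((hcA k).intervalIntegrable _ _)
        (hcA k).stronglyMeasurable.stronglyMeasurableAtFilter (hcA k).continuousAt
    set S := max |L| |x| + 1
    have hx : x ∈ Metric.ball (0:ℝ) S := by
      rw [mem_ball_zero_iff, Real.norm_eq_abs]
      exact (le_max_right _ _).trans_lt (lt_add_one _)
    have hL : |L| ≤ S := (le_max_left _ _).trans (lt_add_one _).le
    have h1 := hasDerivAt_tsum_of_isPreconnected (u := fun k : ℕ => K S * ((K S * S) ^ k / k.factorial * ‖z0‖))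
      (g := fun k => picTerm A z0 (k+1) L) (g' := fun k y => A L y (picTerm A z0 k L y))
      (t := Metric.ball (0:ℝ) S) (y₀ := x) (y := x)
      ((hsum _).mul_left _) Metric.isOpen_ball (convex_ball _ _).isPreconnected
      (fun k y _ => hd k y) (fun k y hy => by
        have hS : 0 ≤ S := (abs_nonneg L).trans hL
        refine ((A L y).le_opNorm _).trans ?_
        have h3 := hb S L y hL (by rw [mem_ball_zero_iff, Real.norm_eq_abs] at hy; exact hy.le) k
        have h4 := (hK L y).trans (hKc hL)
        have := hK0 S hS
        gcongr) hx
      ((summable_nat_add_iff 1).2 (hsm L x)) hx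
    have h2 : (fun x => ∑' k, picTerm A z0 k L x) = fun x => z0 + ∑' k, picTerm A z0 (k+1) L x := by
      funext w
      rw [(hsm L w).tsum_eq_zero_add]
      rfl
    rw [← (A L x).map_tsum (hsm L x)] at h1
    change HasDerivAt (fun x => ∑' k, picTerm A z0 k L x) _ x
    rw [h2]
    exact h1.const_add z0

end LinearODE
/-- First-order system form of the equation with `q = 1/p`, `R = -c r`, `L = -lam`. -/
structure IsSol (q R : ℝ → ℝ) (L : ℝ) (y u m P : ℝ → ℝ) : Prop where
  hy : ∀ x, HasDerivAt y (u x) x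
  hu : ∀ x, HasDerivAt u (q x * m x) x
  hm : ∀ x, HasDerivAt m (P x) x
  hP : ∀ x, HasDerivAt P (L * (q x * m x + R x * y x)) x

/-- The matrix of the system. -/
noncomputable def sysA (q R : ℝ → ℝ) (L t : ℝ) : (ℝ × ℝ × ℝ × ℝ) →L[ℝ] (ℝ × ℝ × ℝ × ℝ) :=
  let p1 : (ℝ × ℝ × ℝ × ℝ) →L[ℝ] ℝ := ContinuousLinearMap.fst ℝ ℝ (ℝ × ℝ × ℝ)
  let s1 := ContinuousLinearMap.snd ℝ ℝ (ℝ × ℝ × ℝ)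
  let p2 : (ℝ × ℝ × ℝ × ℝ) →L[ℝ] ℝ := (ContinuousLinearMap.fst ℝ ℝ (ℝ × ℝ)).comp s1
  let s2 := (ContinuousLinearMap.snd ℝ ℝ (ℝ × ℝ)).comp s1
  let p3 : (ℝ × ℝ × ℝ × ℝ) →L[ℝ] ℝ := (ContinuousLinearMap.fst ℝ ℝ ℝ).comp s2
  let p4 : (ℝ × ℝ × ℝ × ℝ) →L[ℝ] ℝ := (ContinuousLinearMap.snd ℝ ℝ ℝ).comp s2
  p2.prod ((q t • p3).prod (p4.prod ((L * q t) • p3 + (L * R t) • p1)))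

lemma sysA_apply (q R : ℝ → ℝ) (L t : ℝ) (z : ℝ × ℝ × ℝ × ℝ) :
    sysA q R L t z = (z.2.1, q t * z.2.2.1, z.2.2.2, L * (q t * z.2.2.1 + R t * z.1)) := by
  simp [sysA]
  ring

lemma sysA_cont (q R : ℝ → ℝ) (hq : Continuous q) (hR : Continuous R) :
    Continuous (fun z : ℝ × ℝ => sysA q R z.1 z.2) := by
  rw [continuous_clm_apply]
  intro z
  simp only [sysA_apply]
  fun_prop

lemma sysA_bound (q R : ℝ → ℝ) (B : ℝ) (hq : ∀ x, |q x| ≤ B) (hR : ∀ x, |R x| ≤ B) (L t : ℝ) :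
    ‖sysA q R L t‖ ≤ 1 + B + |L| * (2 * B) := by
  have hB : 0 ≤ B := (abs_nonneg _).trans (hq 0)
  refine ContinuousLinearMap.opNorm_le_bound _ (by positivity) fun z => ?_
  rw [sysA_apply]
  have h1 : |z.1| ≤ ‖z‖ := norm_fst_le z
  have h2' : ‖z.2‖ ≤ ‖z‖ := norm_snd_le z
  have h2 : |z.2.1| ≤ ‖z‖ := (norm_fst_le z.2).trans h2'
  have h3' : ‖z.2.2‖ ≤ ‖z‖ := (norm_snd_le z.2).trans h2'
  have h3 : |z.2.2.1| ≤ ‖z‖ := (norm_fst_le z.2.2).trans h3'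
  have h4 : |z.2.2.2| ≤ ‖z‖ := (norm_snd_le z.2.2).trans h3'
  have hz := norm_nonneg z
  have hL := abs_nonneg L
  have e3 : |q t * z.2.2.1| ≤ B * ‖z‖ := by
    rw [abs_mul]; exact mul_le_mul (hq t) h3 (abs_nonneg _) hB
  have e1 : |R t * z.1| ≤ B * ‖z‖ := by
    rw [abs_mul]; exact mul_le_mul (hR t) h1 (abs_nonneg _) hB
  have e4 : |L * (q t * z.2.2.1 + R t * z.1)| ≤ |L| * (2 * B * ‖z‖) := by
    rw [abs_mul]
    have := abs_add_le (q t * z.2.2.1) (R t * z.1)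
    gcongr
    linarith
  have k1 : 0 ≤ B * ‖z‖ := by positivity
  have k2 : 0 ≤ |L| * (2 * B * ‖z‖) := by positivity
  have k3 : (1 + B + |L| * (2 * B)) * ‖z‖ = ‖z‖ + B * ‖z‖ + |L| * (2 * B * ‖z‖) := by ring
  rw [k3]
  simp only [Prod.norm_def, Real.norm_eq_abs] at *
  refine max_le (by linarith) (max_le (by linarith) (max_le (by linarith) (by linarith)))

lemma isSol_iff (q R : ℝ → ℝ) (L : ℝ) (Z : ℝ → ℝ × ℝ × ℝ × ℝ)
    (h : ∀ x, HasDerivAt Z (sysA q R L x (Z x)) x) :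
    IsSol q R L (fun x => (Z x).1) (fun x => (Z x).2.1) (fun x => (Z x).2.2.1)
      (fun x => (Z x).2.2.2) := by
  simp only [sysA_apply] at h
  have hs : ∀ x, HasDerivAt (fun x => (Z x).2) _ x := fun x => (hasFDerivAt_snd.comp_hasDerivAt x (h x))
  have hss : ∀ x, HasDerivAt (fun x => (Z x).2.2) _ x := fun x => (hasFDerivAt_snd.comp_hasDerivAt x (hs x))
  refine ⟨fun x => ?_, fun x => ?_, fun x => ?_, fun x => ?_⟩
  · exact (hasFDerivAt_fst (𝕜 := ℝ) (p := Z x)).comp_hasDerivAt x (h x)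
  · exact (hasFDerivAt_fst (𝕜 := ℝ) (p := (Z x).2)).comp_hasDerivAt x (hs x)
  · exact (hasFDerivAt_fst (𝕜 := ℝ) (p := (Z x).2.2)).comp_hasDerivAt x (hss x)
  · exact (hasFDerivAt_snd (𝕜 := ℝ) (p := (Z x).2.2)).comp_hasDerivAt x (hss x)

lemma IsSol.vec {q R : ℝ → ℝ} {L : ℝ} {y u m P : ℝ → ℝ} (h : IsSol q R L y u m P) (x : ℝ) :
    HasDerivAt (fun x => (y x, u x, m x, P x)) (sysA q R L x (y x, u x, m x, P x)) x := by
  rw [sysA_apply]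
  exact (h.hy x).prodMk ((h.hu x).prodMk ((h.hm x).prodMk (h.hP x)))

lemma isSol_exists (q R : ℝ → ℝ) (B : ℝ) (hqc : Continuous q) (hRc : Continuous R)
    (hq : ∀ x, |q x| ≤ B) (hR : ∀ x, |R x| ≤ B) (m0 P0 : ℝ) :
    ∃ y u m P : ℝ → ℝ → ℝ, Continuous (fun z : ℝ × ℝ => y z.1 z.2) ∧
      Continuous (fun z : ℝ × ℝ => u z.1 z.2) ∧ Continuous (fun z : ℝ × ℝ => m z.1 z.2) ∧
      Continuous (fun z : ℝ × ℝ => P z.1 z.2) ∧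
      ∀ L, IsSol q R L (y L) (u L) (m L) (P L) ∧ y L 0 = 0 ∧ u L 0 = 0 ∧ m L 0 = m0 ∧ P L 0 = P0 := by
  have hB : 0 ≤ B := (abs_nonneg _).trans (hq 0)
  obtain ⟨Z, hZc, hZ0, hZ⟩ := linODE_exists (sysA q R) (sysA_cont q R hqc hRc)
    (fun s => 1 + B + s * (2 * B)) (fun a b hab => by dsimp only; gcongr) (sysA_bound q R B hq hR)
    ((0, 0, m0, P0) : ℝ × ℝ × ℝ × ℝ)
  refine ⟨fun L x => (Z L x).1, fun L x => (Z L x).2.1, fun L x => (Z L x).2.2.1,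
    fun L x => (Z L x).2.2.2, by fun_prop, by fun_prop, by fun_prop, by fun_prop, fun L =>
    ⟨isSol_iff q R L (Z L) (hZ L), ?_⟩⟩
  simp [hZ0]

/-- Uniqueness on `[0,1]` of solutions with the same data at `0`, vector form. -/
lemma sys_unique (q R : ℝ → ℝ) (B : ℝ) (hq : ∀ x, |q x| ≤ B) (hR : ∀ x, |R x| ≤ B) (L : ℝ)
    (f g : ℝ → ℝ × ℝ × ℝ × ℝ)
    (hf : ∀ x ∈ Icc (0:ℝ) 1, HasDerivWithinAt f (sysA q R L x (f x)) (Icc 0 1) x)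
    (hg : ∀ x ∈ Icc (0:ℝ) 1, HasDerivWithinAt g (sysA q R L x (g x)) (Icc 0 1) x)
    (h0 : f 0 = g 0) : EqOn f g (Icc 0 1) := by
  have key : ∀ f : ℝ → ℝ × ℝ × ℝ × ℝ,
    (∀ x ∈ Icc (0:ℝ) 1, HasDerivWithinAt f (sysA q R L x (f x)) (Icc 0 1) x) →
    ∀ t ∈ Ico (0:ℝ) 1, HasDerivWithinAt f (sysA q R L t (f t)) (Ici t) t := by
    intro f hf t ht
    refine (hf t ⟨ht.1, ht.2.le⟩).mono_of_mem_nhdsWithin ?_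
    exact Filter.mem_of_superset (Icc_mem_nhdsGE ht.2) (Icc_subset_Icc_left ht.1)
  refine ODE_solution_unique (K := ‖1 + B + |L| * (2 * B)‖₊) (v := fun t z => sysA q R L t z) ?_
    (fun x hx => (hf x hx).continuousWithinAt) (key f hf)
    (fun x hx => (hg x hx).continuousWithinAt) (key g hg) h0
  intro t
  refine (sysA q R L t).lipschitz.weaken ?_
  rw [← NNReal.coe_le_coe, coe_nnnorm, coe_nnnorm]
  exact (sysA_bound q R B hq hR L t).trans (le_abs_self _)

/-- Zero data at some point forces the zero solution. -/
lemma IsSol.eq_zero {q R : ℝ → ℝ} {L : ℝ} {y u m P : ℝ → ℝ} (h : IsSol q R L y u m P)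
    (B : ℝ) (hq : ∀ x, |q x| ≤ B) (hR : ∀ x, |R x| ≤ B) (a : ℝ) (h1 : y a = 0) (h2 : u a = 0)
    (h3 : m a = 0) (h4 : P a = 0) (x : ℝ) : m x = 0 ∧ P x = 0 := by
  have := ODE_solution_unique_univ (K := ‖1 + B + |L| * (2 * B)‖₊)
    (v := fun t z => sysA q R L t z) (s := fun _ => univ) (t₀ := a)
    (f := fun x => (y x, u x, m x, P x)) (g := fun _ => 0) (fun t => by
      refine LipschitzWith.lipschitzOnWith ?_
      refine (sysA q R L t).lipschitz.weaken ?_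
      rw [← NNReal.coe_le_coe, coe_nnnorm, coe_nnnorm]
      exact (sysA_bound q R B hq hR L t).trans (le_abs_self _))
    (fun t => ⟨h.vec t, trivial⟩)
    (fun t => ⟨by simpa using hasDerivAt_const t (0 : ℝ × ℝ × ℝ × ℝ), trivial⟩)
    (by simp [h1, h2, h3, h4])
  have := congrFun this x
  simp only [Prod.mk_eq_zero] at this
  exact this.2.2

lemma IsSol.comb {q R : ℝ → ℝ} {L : ℝ} {y u m P y' u' m' P' : ℝ → ℝ} (h : IsSol q R L y u m P)
    (h' : IsSol q R L y' u' m' P') (a b : ℝ) :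
    IsSol q R L (fun x => a * y x + b * y' x) (fun x => a * u x + b * u' x)
      (fun x => a * m x + b * m' x) (fun x => a * P x + b * P' x) := by
  refine ⟨fun x => ?_, fun x => ?_, fun x => ?_, fun x => ?_⟩
  · exact ((h.hy x).const_mul a).add ((h'.hy x).const_mul b)
  · exact (((h.hu x).const_mul a).add ((h'.hu x).const_mul b)).congr_deriv (by ring)
  · exact ((h.hm x).const_mul a).add ((h'.hm x).const_mul b)
  · exact (((h.hP x).const_mul a).add ((h'.hP x).const_mul b)).congr_deriv (by ring)

lemma IsSol.smul {q R : ℝ → ℝ} {L : ℝ} {y u m P : ℝ → ℝ} (h : IsSol q R L y u m P) (a : ℝ) :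
    IsSol q R L (fun x => a * y x) (fun x => a * u x) (fun x => a * m x) (fun x => a * P x) := by
  simpa using h.comb h a 0

/-- Reflection `x ↦ -x`. -/
lemma IsSol.reflect {q R : ℝ → ℝ} {L : ℝ} {y u m P : ℝ → ℝ} (h : IsSol q R L y u m P) :
    IsSol (fun x => q (-x)) (fun x => R (-x)) L (fun x => y (-x)) (fun x => -u (-x))
      (fun x => m (-x)) (fun x => -P (-x)) := by
  refine ⟨fun x => ?_, fun x => ?_, fun x => ?_, fun x => ?_⟩
  · exact ((h.hy (-x)).comp x (hasDerivAt_neg x)).congr_deriv (by ring)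
  · exact (((h.hu (-x)).comp x (hasDerivAt_neg x)).neg).congr_deriv (by ring)
  · exact ((h.hm (-x)).comp x (hasDerivAt_neg x)).congr_deriv (by ring)
  · exact (((h.hP (-x)).comp x (hasDerivAt_neg x)).neg).congr_deriv (by ring)
lemma le_of_hasDerivAt_nonneg {f f' : ℝ → ℝ} {a b : ℝ} (h : ∀ x, HasDerivAt f (f' x) x)
    (hab : a ≤ b) (hf : ∀ x ∈ Ioo a b, 0 ≤ f' x) : f a ≤ f b := by
  have := monotoneOn_of_deriv_nonneg (convex_Icc a b)
    (fun x _ => (h x).continuousAt.continuousWithinAt)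
    (fun x _ => (h x).differentiableAt.differentiableWithinAt)
    (fun x hx => by rw [interior_Icc] at hx; rw [(h x).deriv]; exact hf x hx)
  exact this (left_mem_Icc.2 hab) (right_mem_Icc.2 hab) hab

lemma lt_of_hasDerivAt_pos {f f' : ℝ → ℝ} {a b : ℝ} (h : ∀ x, HasDerivAt f (f' x) x)
    (hab : a < b) (hf : ∀ x ∈ Ioo a b, 0 < f' x) : f a < f b := by
  have := strictMonoOn_of_deriv_pos (convex_Icc a b)
    (fun x _ => (h x).continuousAt.continuousWithinAt)
    (fun x hx => by rw [interior_Icc] at hx; rw [(h x).deriv]; exact hf x hx)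
  exact this (left_mem_Icc.2 hab.le) (right_mem_Icc.2 hab.le) hab

lemma first_exit {g : ℝ → ℝ} {a b : ℝ} (hg : Continuous g) (ha : 0 < g a)
    (h : ∀ x, a < x → x ≤ b → (∀ t ∈ Ico a x, 0 < g t) → g a ≤ g x) :
    ∀ x ∈ Icc a b, 0 < g x := by
  by_contra hcon
  push Not at hcon
  obtain ⟨x0, hx0, hgx0⟩ := hcon
  set S := Icc a b ∩ {x | g x ≤ 0} with hS
  have hSc : IsClosed S := isClosed_Icc.inter (isClosed_le hg continuous_const)
  have hne : S.Nonempty := ⟨x0, hx0, hgx0⟩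
  have hbb : BddBelow S := ⟨a, fun x hx => hx.1.1⟩
  have hmem := hSc.csInf_mem hne hbb
  set x1 := sInf S
  have hax : a < x1 := by
    rcases hmem.1.1.lt_or_eq with h1 | h1
    · exact h1
    · exfalso
      have := hmem.2
      simp only [mem_ofPred_eq, ← h1] at this
      linarith
  have h2 := h x1 hax hmem.1.2 (fun t ht => by
    by_contra hc
    have : x1 ≤ t := csInf_le hbb ⟨⟨ht.1, ht.2.le.trans hmem.1.2⟩, not_lt.1 hc⟩
    exact absurd ht.2 (not_lt.2 this))
  have := hmem.2
  simp only [mem_ofPred_eq] at this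
  linarith

lemma IsSol.pos_chain {q R : ℝ → ℝ} {L : ℝ} {y u m P : ℝ → ℝ} (h : IsSol q R L y u m P)
    (hq : ∀ x, 0 < q x) {a b : ℝ} (hab : a < b) (hya : y a = 0) (hua : u a = 0)
    (hm : ∀ x ∈ Ioo a b, 0 < m x) : 0 < y b ∧ 0 < u b := by
  have hu : ∀ x ∈ Ioc a b, 0 < u x := fun x hx => by
    rw [← hua]
    exact lt_of_hasDerivAt_pos h.hu hx.1
      (fun t ht => mul_pos (hq t) (hm t ⟨ht.1, ht.2.trans_le hx.2⟩))
  refine ⟨?_, hu b ⟨hab, le_rfl⟩⟩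
  rw [← hya]
  exact lt_of_hasDerivAt_pos h.hy hab (fun t ht => hu t ⟨ht.1, ht.2.le⟩)

lemma IsSol.pos {q R : ℝ → ℝ} {L : ℝ} {y u m P : ℝ → ℝ} (h : IsSol q R L y u m P)
    (hq : ∀ x, 0 < q x) (hR : ∀ x, 0 < R x) (hL : 0 ≤ L) {a b : ℝ} (hab : a < b)
    (hya : y a = 0) (hua : u a = 0) (hma : 0 ≤ m a) (hPa : 0 ≤ P a) (hne : 0 < m a ∨ 0 < P a) :
    0 < y b ∧ 0 < u b := by
  have hch : ∀ x, (∀ t ∈ Ioo a x, 0 ≤ m t) → ∀ t ∈ Icc a x, P a ≤ P t := by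
    intro x hm t ht
    have hu : ∀ s ∈ Icc a x, 0 ≤ u s := fun s hs => by
      rw [← hua]
      exact le_of_hasDerivAt_nonneg h.hu hs.1
        (fun w hw => mul_nonneg (hq w).le (hm w ⟨hw.1, hw.2.trans_le hs.2⟩))
    have hy : ∀ s ∈ Icc a x, 0 ≤ y s := fun s hs => by
      rw [← hya]
      exact le_of_hasDerivAt_nonneg h.hy hs.1
        (fun w hw => hu w ⟨hw.1.le, hw.2.le.trans hs.2⟩)
    refine le_of_hasDerivAt_nonneg h.hP ht.1 (fun w hw => ?_)
    have h1 := mul_nonneg (hq w).le (hm w ⟨hw.1, hw.2.trans_le ht.2⟩)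
    have h2 := mul_nonneg (hR w).le (hy w ⟨hw.1.le, hw.2.le.trans ht.2⟩)
    positivity
  rcases hne with hm0 | hP0
  · have hm := first_exit (g := m) (b := b)
      (continuous_iff_continuousAt.2 fun x => (h.hm x).continuousAt) hm0
      (fun x hx _ ht => by
        refine le_of_hasDerivAt_nonneg h.hm hx.le fun w hw => ?_
        exact hPa.trans (hch x (fun t h' => (ht t ⟨h'.1.le, h'.2⟩).le) w ⟨hw.1.le, hw.2.le⟩))
    exact h.pos_chain hq hab hya hua (fun x hx => hm x ⟨hx.1.le, hx.2.le⟩)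
  · have hP := first_exit (g := P) (b := b)
      (continuous_iff_continuousAt.2 fun x => (h.hP x).continuousAt) hP0
      (fun x hx _ ht => by
        refine hch x (fun t h' => ?_) x ⟨hx.le, le_rfl⟩
        exact hma.trans (le_of_hasDerivAt_nonneg h.hm h'.1.le
          (fun w hw => (ht w ⟨hw.1.le, hw.2.trans h'.2⟩).le)))
    refine h.pos_chain hq hab hya hua (fun x hx => ?_)
    refine hma.trans_lt (lt_of_hasDerivAt_pos h.hm hx.1 (fun w hw => ?_))
    exact hP w ⟨hw.1.le, hw.2.le.trans hx.2.le⟩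

lemma IsSol.back {q R : ℝ → ℝ} {L : ℝ} {y u m P : ℝ → ℝ} (h : IsSol q R L y u m P)
    (hq : ∀ x, 0 < q x) (hR : ∀ x, 0 < R x) (hL : 0 ≤ L) {a b : ℝ} (hab : a < b)
    (hyb : y b = 0) (hub : u b = 0) (hmb : 0 ≤ m b) (hPb : P b ≤ 0) (hne : 0 < m b ∨ P b < 0) :
    0 < y a := by
  have := (h.reflect.pos (fun x => hq _) (fun x => hR _) hL (neg_lt_neg hab) (by simpa using hyb)
    (by simpa using hub) (by simpa using hmb) (by simpa using hPb) (by simpa using hne)).1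
  simpa using this

/-- Main hypothesis package: coefficients are positive and bounded. -/
structure Coef (q R : ℝ → ℝ) (B : ℝ) : Prop where
  qc : Continuous q
  Rc : Continuous R
  q0 : ∀ x, 0 < q x
  R0 : ∀ x, 0 < R x
  qB : ∀ x, |q x| ≤ B
  RB : ∀ x, |R x| ≤ B

lemma IsSol.double {q R : ℝ → ℝ} {B L : ℝ} {y u m P : ℝ → ℝ} (h : IsSol q R L y u m P)
    (H : Coef q R B) (hL : 0 ≤ L) (hy0 : y 0 = 0) (hm0 : m 0 ≠ 0)
    {a : ℝ} (ha : 0 < a) (hya : y a = 0) (hua : u a = 0) : 0 < m a * P a := by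
  have hn := h.smul (-1)
  by_contra hcon
  by_cases hz : m a = 0 ∧ P a = 0
  · exact hm0 (h.eq_zero B H.qB H.RB a hya hua hz.1 hz.2 0).1
  have hsg : (0 ≤ m a ∧ P a ≤ 0) ∨ (m a ≤ 0 ∧ 0 ≤ P a) := by
    rcases le_total 0 (m a) with h1 | h1 <;> rcases le_total 0 (P a) with h2 | h2
    · by_cases h3 : m a = 0
      · exact Or.inr ⟨h3.le, h2⟩
      · by_cases h4 : P a = 0
        · exact Or.inl ⟨h1, h4.le⟩
        · exact absurd (mul_pos (lt_of_le_of_ne h1 (Ne.symm h3)) (lt_of_le_of_ne h2 (Ne.symm h4))) hcon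
    · exact Or.inl ⟨h1, h2⟩
    · exact Or.inr ⟨h1, h2⟩
    · by_cases h3 : m a = 0
      · exact Or.inl ⟨h3.ge, h2⟩
      · by_cases h4 : P a = 0
        · exact Or.inr ⟨h1, h4.ge⟩
        · exact absurd (mul_pos_of_neg_of_neg (lt_of_le_of_ne h1 h3) (lt_of_le_of_ne h2 h4)) hcon
  rcases hsg with ⟨h1, h2⟩ | ⟨h1, h2⟩
  · have := h.back H.q0 H.R0 hL ha hya hua h1 h2 (by
      rcases h1.lt_or_eq with h3 | h3
      · exact Or.inl h3
      · exact Or.inr (lt_of_le_of_ne h2 fun h4 => hz ⟨h3.symm, h4⟩))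
    linarith
  · have := hn.back H.q0 H.R0 hL ha (by simp [hya]) (by simp [hua]) (by simpa using h1)
      (by simpa using h2) (by
      rcases h1.lt_or_eq with h3 | h3
      · exact Or.inl (by simpa using h3)
      · exact Or.inr (by simpa using lt_of_le_of_ne h2 fun h4 => hz ⟨h3, h4.symm⟩))
    linarith

lemma IsSol.simple {q R : ℝ → ℝ} {B L : ℝ} {y u m P : ℝ → ℝ} (h : IsSol q R L y u m P)
    (H : Coef q R B) (hL : 0 ≤ L) (hy0 : y 0 = 0) (hm0 : m 0 ≠ 0) (hu1 : u 1 = 0)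
    {a : ℝ} (ha : a ∈ Ioo (0:ℝ) 1) (hya : y a = 0) : u a ≠ 0 := by
  intro hua
  have hmp := h.double H hL hy0 hm0 ha.1 hya hua
  rcases mul_pos_iff.1 hmp with ⟨h1, h2⟩ | ⟨h1, h2⟩
  · have := (h.pos H.q0 H.R0 hL ha.2 hya hua h1.le h2.le (Or.inl h1)).2
    linarith
  · have := ((h.smul (-1)).pos H.q0 H.R0 hL ha.2 (by simp [hya]) (by simp [hua])
      (by simpa using h1.le) (by simpa using h2.le) (Or.inl (by simpa using h1))).2
    linarith

lemma IsSol.contm {q R : ℝ → ℝ} {L : ℝ} {y u m P : ℝ → ℝ} (h : IsSol q R L y u m P) :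
    Continuous m := continuous_iff_continuousAt.2 fun x => (h.hm x).continuousAt

lemma IsSol.green {q R : ℝ → ℝ} (hqc : Continuous q) {L₁ L₂ : ℝ}
    {y₁ u₁ m₁ P₁ y₂ u₂ m₂ P₂ : ℝ → ℝ}
    (h₁ : IsSol q R L₁ y₁ u₁ m₁ P₁) (h₂ : IsSol q R L₂ y₂ u₂ m₂ P₂)
    (hy₁ : y₁ 0 = 0) (hu₁ : u₁ 0 = 0) (hu₁' : u₁ 1 = 0)
    (hy₂ : y₂ 0 = 0) (hu₂ : u₂ 0 = 0) (hu₂' : u₂ 1 = 0) :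
    L₂ * (P₁ 1 * y₂ 1) - L₁ * (P₂ 1 * y₁ 1) = (L₁ - L₂) * ∫ x in (0:ℝ)..1, q x * m₁ x * m₂ x := by
  have hc1 := h₁.contm
  have hc2 := h₂.contm
  have hd : ∀ x, HasDerivAt (fun x => L₂ * (P₁ x * y₂ x - m₁ x * u₂ x)
      - L₁ * (P₂ x * y₁ x - m₂ x * u₁ x) - L₁ * L₂ * (u₁ x * y₂ x - u₂ x * y₁ x))
      ((L₁ - L₂) * (q x * m₁ x * m₂ x)) x := fun x => by
    refine HasDerivAt.congr_deriv
      ((((((h₁.hP x).mul (h₂.hy x)).sub ((h₁.hm x).mul (h₂.hu x))).const_mul L₂).sub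
      ((((h₂.hP x).mul (h₁.hy x)).sub ((h₂.hm x).mul (h₁.hu x))).const_mul L₁)).sub
      ((((h₁.hu x).mul (h₂.hy x)).sub ((h₂.hu x).mul (h₁.hy x))).const_mul (L₁ * L₂))) ?_
    ring
  have := intervalIntegral.integral_eq_sub_of_hasDerivAt (a := 0) (b := 1) (fun x _ => hd x)
    (Continuous.intervalIntegrable (by fun_prop) _ _)
  rw [intervalIntegral.integral_const_mul] at this
  rw [this]
  simp only [hy₁, hu₁, hu₁', hy₂, hu₂, hu₂']
  ring

lemma IsSol.energy0 {q R : ℝ → ℝ} (hqc : Continuous q) {y u m P : ℝ → ℝ}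
    (h : IsSol q R 0 y u m P) (hy0 : y 0 = 0) (hu0 : u 0 = 0) (hu1 : u 1 = 0) :
    P 1 * y 1 = - ∫ x in (0:ℝ)..1, q x * m x * m x := by
  have hc1 := h.contm
  have hd : ∀ x, HasDerivAt (fun x => P x * y x - m x * u x)
      (-(q x * m x * m x)) x := fun x => by
    refine HasDerivAt.congr_deriv (((h.hP x).mul (h.hy x)).sub ((h.hm x).mul (h.hu x))) ?_
    ring
  have := intervalIntegral.integral_eq_sub_of_hasDerivAt (a := 0) (b := 1) (fun x _ => hd x)
    (Continuous.intervalIntegrable (by fun_prop) _ _)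
  rw [intervalIntegral.integral_neg] at this
  rw [this]
  simp only [hy0, hu0, hu1]
  ring

lemma energy_pos {q m : ℝ → ℝ} (hqc : Continuous q) (hq : ∀ x, 0 < q x) (hm : Continuous m)
    (hm0 : m 0 ≠ 0) : 0 < ∫ x in (0:ℝ)..1, q x * m x * m x := by
  refine intervalIntegral.integral_pos (by norm_num) (by fun_prop) (fun x _ => ?_)
    ⟨0, by simp, ?_⟩
  · rw [mul_assoc]; exact mul_nonneg (hq x).le (mul_self_nonneg _)
  · rw [mul_assoc]; exact mul_pos (hq 0) (mul_self_pos.2 hm0)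
lemma zeros_finite {f f' : ℝ → ℝ} (hd : ∀ x, HasDerivAt f (f' x) x) {a b : ℝ}
    (hs : ∀ x ∈ Icc a b, f x = 0 → f' x ≠ 0) : {x ∈ Icc a b | f x = 0}.Finite := by
  by_contra hinf
  have hc : Continuous f := continuous_iff_continuousAt.2 fun x => (hd x).continuousAt
  obtain ⟨x, hx, hacc⟩ := Set.Infinite.exists_accPt_of_subset_isCompact (K := Icc a b) hinf
    isCompact_Icc (fun x hx => hx.1)
  have hcl : IsClosed {x ∈ Icc a b | f x = 0} :=
    isClosed_Icc.inter (isClosed_eq hc continuous_const)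
  have hx0 : x ∈ {x ∈ Icc a b | f x = 0} := by
    have := hacc.clusterPt
    exact isClosed_iff_clusterPt.1 hcl x this
  have h1 := (hd x).eventually_ne (c := 0) (hs x hx hx0.2)
  rw [accPt_iff_frequently_nhdsNE] at hacc
  obtain ⟨w, hw1, hw2⟩ := (hacc.and_eventually h1).exists
  exact hw2 hw1.2

lemma zeros_count (y u : ℝ → ℝ → ℝ) (hyc : Continuous (fun z : ℝ × ℝ => y z.1 z.2))
    (huc : Continuous (fun z : ℝ × ℝ => u z.1 z.2)) (hd : ∀ L x, HasDerivAt (y L) (u L x) x)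
    (L₀ a b : ℝ) (ha : y L₀ a ≠ 0) (hb : y L₀ b ≠ 0)
    (hs : ∀ x ∈ Icc a b, y L₀ x = 0 → u L₀ x ≠ 0) :
    ∀ᶠ L in nhds L₀, {x ∈ Icc a b | y L x = 0}.Finite ∧
      {x ∈ Icc a b | y L x = 0}.ncard = {x ∈ Icc a b | y L₀ x = 0}.ncard := by
  have hfin : {x ∈ Icc a b | y L₀ x = 0}.Finite := zeros_finite (hd L₀) hs
  set Z := {x ∈ Icc a b | y L₀ x = 0} with hZ
  have hyc' : ∀ L, Continuous (y L) := fun L =>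
    hyc.comp (by fun_prop : Continuous fun t : ℝ => (L, t))
  have huc' : ∀ L, Continuous (u L) := fun L =>
    huc.comp (by fun_prop : Continuous fun t : ℝ => (L, t))
  have hyL : ∀ x, Continuous (fun L => y L x) := fun x =>
    hyc.comp (by fun_prop : Continuous fun t : ℝ => (t, x))
  -- choose the radius
  have hε : ∃ ε > 0, ∀ z ∈ Z, (Icc (z - ε) (z + ε) ⊆ Icc a b) ∧
      (∀ x ∈ Icc (z - ε) (z + ε), 0 < u L₀ x * u L₀ z) ∧ (∀ w ∈ Z, w ≠ z → 2 * ε < |w - z|) := by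
    have h1 : ∀ z ∈ Z, ∀ᶠ ε in nhdsWithin (0:ℝ) (Ioi 0), (Icc (z - ε) (z + ε) ⊆ Icc a b) ∧
      (∀ x ∈ Icc (z - ε) (z + ε), 0 < u L₀ x * u L₀ z) ∧ (∀ w ∈ Z, w ≠ z → 2 * ε < |w - z|) := by
      intro z hz
      have haz : a < z := lt_of_le_of_ne hz.1.1 (fun h => ha (h ▸ hz.2))
      have hzb : z < b := lt_of_le_of_ne hz.1.2 (fun h => hb (h ▸ hz.2))
      have hu2 : ∀ᶠ x in nhds z, x ∈ Icc a b ∧ 0 < u L₀ x * u L₀ z := by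
        have hI : ∀ᶠ x in nhds z, x ∈ Icc a b := Icc_mem_nhds haz hzb
        refine hI.and ?_
        have : Continuous fun x => u L₀ x * u L₀ z := (huc' L₀).mul continuous_const
        exact this.continuousAt.eventually (lt_mem_nhds (mul_self_pos.2 (hs z hz.1 hz.2)))
      rw [Metric.nhds_basis_closedBall.eventually_iff] at hu2
      obtain ⟨δ, hδ, hball⟩ := hu2
      have e1 : ∀ᶠ ε in nhdsWithin (0:ℝ) (Ioi 0), ε < δ :=
        Filter.Eventually.filter_mono nhdsWithin_le_nhds (gt_mem_nhds hδ)
      have e2 : ∀ᶠ ε in nhdsWithin (0:ℝ) (Ioi 0), ∀ w ∈ Z, w ≠ z → 2 * ε < |w - z| := by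
        rw [Filter.eventually_all_finite hfin]
        intro w hw
        by_cases hwz : w = z
        · simp [hwz]
        · have : 0 < |w - z| / 2 := half_pos (abs_pos.2 (sub_ne_zero.2 hwz))
          filter_upwards [Filter.Eventually.filter_mono nhdsWithin_le_nhds (gt_mem_nhds this)]
            with ε hε _
          linarith
      filter_upwards [e1, e2] with ε h1 h2
      have hsub : ∀ x ∈ Icc (z - ε) (z + ε), x ∈ Metric.closedBall z δ := fun x hx => by
        rw [Metric.mem_closedBall, Real.dist_eq, abs_le]
        constructor <;> linarith [hx.1, hx.2]
      exact ⟨fun x hx => (hball (hsub x hx)).1, fun x hx => (hball (hsub x hx)).2, h2⟩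
    rw [← Filter.eventually_all_finite hfin] at h1
    obtain ⟨ε, h2, h3⟩ := (h1.and self_mem_nhdsWithin).exists
    exact ⟨ε, h3, h2⟩
  obtain ⟨ε, hε0, hε⟩ := hε
  have hu_ev : ∀ᶠ L in nhds L₀, ∀ z ∈ Z, ∀ x ∈ Icc (z - ε) (z + ε), 0 < u L x * u L₀ z := by
    rw [Filter.eventually_all_finite hfin]
    intro z hz
    refine isCompact_Icc.eventually_forall_of_forall_eventually fun x hx => ?_
    have : Continuous fun w : ℝ × ℝ => u w.1 w.2 * u L₀ z := huc.mul continuous_const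
    exact this.continuousAt.eventually (lt_mem_nhds ((hε z hz).2.1 x hx))
  have hends : ∀ z ∈ Z, y L₀ (z - ε) * u L₀ z < 0 ∧ 0 < y L₀ (z + ε) * u L₀ z := by
    intro z hz
    have hd' : ∀ x, HasDerivAt (fun x => y L₀ x * u L₀ z) (u L₀ x * u L₀ z) x := fun x =>
      (hd L₀ x).mul_const _
    have h1 := lt_of_hasDerivAt_pos hd' (a := z - ε) (b := z) (by linarith)
      (fun x hx => (hε z hz).2.1 x ⟨hx.1.le, by linarith [hx.2]⟩)
    have h2 := lt_of_hasDerivAt_pos hd' (a := z) (b := z + ε) (by linarith)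
      (fun x hx => (hε z hz).2.1 x ⟨by linarith [hx.1], hx.2.le⟩)
    have h3 := hz.2
    simp only [h3, zero_mul] at h1 h2
    exact ⟨h1, h2⟩
  have hends_ev : ∀ᶠ L in nhds L₀, ∀ z ∈ Z, y L (z - ε) * u L₀ z < 0 ∧ 0 < y L (z + ε) * u L₀ z := by
    rw [Filter.eventually_all_finite hfin]
    intro z hz
    have c1 : Continuous fun L => y L (z - ε) * u L₀ z := (hyL _).mul continuous_const
    have c2 : Continuous fun L => y L (z + ε) * u L₀ z := (hyL _).mul continuous_const
    exact (c1.continuousAt.eventually (gt_mem_nhds (hends z hz).1)).and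
      (c2.continuousAt.eventually (lt_mem_nhds (hends z hz).2))
  set K := Icc a b \ ⋃ z ∈ Z, Ioo (z - ε) (z + ε) with hKdef
  have hK : IsCompact K := isCompact_Icc.diff (isOpen_biUnion fun z _ => isOpen_Ioo)
  have hK_ev : ∀ᶠ L in nhds L₀, ∀ x ∈ K, y L x ≠ 0 := by
    refine hK.eventually_forall_of_forall_eventually fun x hx => ?_
    refine (hyc.continuousAt (x := (L₀, x))).eventually_ne ?_
    intro h0
    apply hx.2
    have hxZ : x ∈ Z := ⟨hx.1, h0⟩
    simp only [mem_iUnion]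
    exact ⟨x, hxZ, by linarith, by linarith⟩
  filter_upwards [hu_ev, hends_ev, hK_ev] with L h1 h2 h3
  -- unique zero in each interval
  have hinj : ∀ z ∈ Z, ∀ x ∈ Icc (z - ε) (z + ε), ∀ x' ∈ Icc (z - ε) (z + ε),
      y L x = 0 → y L x' = 0 → x = x' := by
    have key : ∀ z ∈ Z, ∀ x ∈ Icc (z - ε) (z + ε), ∀ x' ∈ Icc (z - ε) (z + ε),
      y L x = 0 → y L x' = 0 → ¬ x < x' := by
      intro z hz x hx x' hx' e1 e2 hlt
      have := lt_of_hasDerivAt_pos (fun x => (hd L x).mul_const (u L₀ z)) hlt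
        (fun t ht => h1 z hz t ⟨hx.1.trans ht.1.le, ht.2.le.trans hx'.2⟩)
      simp [e1, e2] at this
    intro z hz x hx x' hx' e1 e2
    exact le_antisymm (not_lt.1 (key z hz x' hx' x hx e2 e1)) (not_lt.1 (key z hz x hx x' hx' e1 e2))
  have hex : ∀ z, ∃ x, z ∈ Z → x ∈ Ioo (z - ε) (z + ε) ∧ y L x = 0 := by
    intro z
    by_cases hz : z ∈ Z
    · have hcont : ContinuousOn (fun x => y L x * u L₀ z) (Icc (z - ε) (z + ε)) :=
        ((hyc' L).mul continuous_const).continuousOn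
      obtain ⟨x, hx, hx0⟩ := intermediate_value_Ioo (by linarith : z - ε ≤ z + ε) hcont
        (show (0:ℝ) ∈ Ioo _ _ from h2 z hz)
      refine ⟨x, fun _ => ⟨hx, ?_⟩⟩
      rcases mul_eq_zero.1 hx0 with h | h
      · exact h
      · exact absurd h (hs z hz.1 hz.2)
    · exact ⟨0, fun h => absurd h hz⟩
  choose g hg using hex
  have himg : {x ∈ Icc a b | y L x = 0} = g '' Z := by
    ext x
    constructor
    · rintro ⟨hx, hx0⟩
      have hxK : x ∉ K := fun h => h3 x h hx0
      have : x ∈ ⋃ z ∈ Z, Ioo (z - ε) (z + ε) := by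
        by_contra hc
        exact hxK ⟨hx, hc⟩
      simp only [mem_iUnion] at this
      obtain ⟨z, hz, hxz⟩ := this
      exact ⟨z, hz, hinj z hz _ (Ioo_subset_Icc_self (hg z hz).1) _ (Ioo_subset_Icc_self hxz)
        (hg z hz).2 hx0⟩
    · rintro ⟨z, hz, rfl⟩
      exact ⟨(hε z hz).1 (Ioo_subset_Icc_self (hg z hz).1), (hg z hz).2⟩
  rw [himg]
  refine ⟨hfin.image g, Set.InjOn.ncard_image ?_⟩
  intro z hz w hw hzw
  by_contra hne
  have e1 := (hg z hz).1
  have e2 := (hg w hw).1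
  rw [← hzw] at e2
  have e3 := (hε w hw).2.2 z hz hne
  have : |z - w| < 2 * ε := by
    rw [abs_lt]
    constructor <;> linarith [e1.1, e1.2, e2.1, e2.2]
  linarith

/-- Abstract counting: the jump of `C` records the points of `S`. -/
lemma count_abstract (C : ℝ → ℕ) (S : Set ℝ) (h0 : C 0 = 0)
    (hloc : ∀ L₀, 0 ≤ L₀ → ∀ᶠ L in nhds L₀, 0 ≤ L → (L ≠ L₀ → L ∉ S) ∧ (L ≤ L₀ → C L = C L₀) ∧
      (L₀ < L → (L₀ ∈ S → C L = C L₀ + 1) ∧ (L₀ ∉ S → C L = C L₀))) :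
    ∀ L, 0 ≤ L → (S ∩ Ico 0 L).Finite ∧ (S ∩ Ico 0 L).ncard = C L := by
  set Q : ℝ → Prop := fun L => (S ∩ Ico 0 L).Finite ∧ (S ∩ Ico 0 L).ncard = C L with hQ
  -- comparing two points with no point of `S` strictly between
  have hstep : ∀ a b, 0 ≤ a → a < b → (∀ x ∈ Ioo a b, x ∉ S) →
      ((a ∈ S → C b = C a + 1) ∧ (a ∉ S → C b = C a)) → (Q a ↔ Q b) := by
    intro a b ha hab hno hC
    by_cases haS : a ∈ S
    · have hset : S ∩ Ico 0 b = insert a (S ∩ Ico 0 a) := by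
        ext x
        simp only [mem_inter_iff, mem_Ico, mem_insert_iff]
        constructor
        · rintro ⟨h1, h2, h3⟩
          rcases lt_trichotomy x a with h | h | h
          · exact Or.inr ⟨h1, h2, h⟩
          · exact Or.inl h
          · exact absurd h1 (hno x ⟨h, h3⟩)
        · rintro (rfl | ⟨h1, h2, h3⟩)
          · exact ⟨haS, ha, hab⟩
          · exact ⟨h1, h2, h3.trans hab⟩
      have hna : a ∉ S ∩ Ico 0 a := fun h => lt_irrefl a h.2.2
      simp only [hQ, hset, hC.1 haS]
      constructor
      · rintro ⟨h1, h2⟩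
        exact ⟨h1.insert a, by rw [Set.ncard_insert_of_notMem hna h1, h2]⟩
      · rintro ⟨h1, h2⟩
        have h3 : (S ∩ Ico 0 a).Finite := h1.subset (subset_insert _ _)
        rw [Set.ncard_insert_of_notMem hna h3] at h2
        exact ⟨h3, by omega⟩
    · have hset : S ∩ Ico 0 b = S ∩ Ico 0 a := by
        ext x
        simp only [mem_inter_iff, mem_Ico]
        constructor
        · rintro ⟨h1, h2, h3⟩
          rcases lt_trichotomy x a with h | h | h
          · exact ⟨h1, h2, h⟩
          · exact absurd (h ▸ h1) haS
          · exact absurd h1 (hno x ⟨h, h3⟩)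
        · rintro ⟨h1, h2, h3⟩
          exact ⟨h1, h2, h3.trans hab⟩
      simp only [hQ, hset, hC.2 haS]
  have hQloc : ∀ L₀, 0 ≤ L₀ → ∀ᶠ L in nhds L₀, 0 ≤ L → (Q L ↔ Q L₀) := by
    intro L₀ hL₀
    have h1 := hloc L₀ hL₀
    rw [Metric.nhds_basis_ball.eventually_iff] at h1 ⊢
    obtain ⟨δ, hδ, hb⟩ := h1
    refine ⟨δ, hδ, fun L hLb hL => ?_⟩
    have hlt := Metric.mem_ball.1 hLb
    rw [Real.dist_eq, abs_lt] at hlt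
    have hmem : ∀ x, L₀ - δ < x → x < L₀ + δ → x ∈ Metric.ball L₀ δ := fun x h1 h2 => by
      rw [Metric.mem_ball, Real.dist_eq, abs_lt]; constructor <;> linarith
    rcases lt_trichotomy L L₀ with h | h | h
    · refine hstep L L₀ hL h (fun x hx => ?_) ⟨fun hS => ?_, fun _ => ((hb hLb hL).2.1 h.le).symm⟩
      · exact (hb (hmem x (by linarith [hx.1]) (by linarith [hx.2])) (hL.trans hx.1.le)).1 hx.2.ne
      · exact absurd hS ((hb hLb hL).1 h.ne)
    · rw [h]
    · refine (hstep L₀ L hL₀ h (fun x hx => ?_) ((hb hLb hL).2.2 h)).symm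
      exact (hb (hmem x (by linarith [hx.1]) (by linarith [hx.2])) (hL₀.trans hx.1.le)).1 hx.1.ne'
  have hQloc' : ∀ L₀, ∀ᶠ L in nhds L₀, (Q (max L 0) ↔ Q (max L₀ 0)) := by
    intro L₀
    have hc : Continuous fun L : ℝ => max L 0 := by fun_prop
    filter_upwards [hc.continuousAt.eventually (hQloc (max L₀ 0) (le_max_right _ _))] with L h
    exact h (le_max_right _ _)
  have hopen : ∀ T : Prop → Prop, IsOpen {L | T (Q (max L 0))} := by
    intro T
    rw [isOpen_iff_mem_nhds]
    intro L₀ hT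
    filter_upwards [hQloc' L₀] with L h
    have : Q (max L 0) = Q (max L₀ 0) := propext h
    show T (Q (max L 0))
    rw [this]
    exact hT
  have hclopen : IsClopen {L | Q (max L 0)} := by
    refine ⟨⟨?_⟩, hopen id⟩
    exact hopen Not
  have h00 : (0:ℝ) ∈ {L | Q (max L 0)} := by
    show Q (max 0 0)
    simp [hQ, h0]
  have huniv := hclopen.eq_univ ⟨0, h00⟩
  intro L hL
  have : L ∈ {L | Q (max L 0)} := by rw [huniv]; trivial
  have h2 : Q (max L 0) := this
  rwa [max_eq_left hL] at h2
/-- The family of solutions with `y(0) = y'(0) = y'(1) = 0`, normalised. -/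
structure Fam (q R : ℝ → ℝ) (y u m P : ℝ → ℝ → ℝ) : Prop where
  yc : Continuous (fun z : ℝ × ℝ => y z.1 z.2)
  uc : Continuous (fun z : ℝ × ℝ => u z.1 z.2)
  mc : Continuous (fun z : ℝ × ℝ => m z.1 z.2)
  Pc : Continuous (fun z : ℝ × ℝ => P z.1 z.2)
  sol : ∀ L, IsSol q R L (y L) (u L) (m L) (P L)
  y0 : ∀ L, y L 0 = 0
  u0 : ∀ L, u L 0 = 0
  u1 : ∀ L, u L 1 = 0
  m0 : ∀ L, 0 ≤ L → 0 < m L 0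
  P0 : ∀ L, 0 ≤ L → P L 0 < 0

/-- Every solution with zero Cauchy data `y(0)=u(0)=0`, `u(1)=0` is a multiple of the family. -/
lemma fam_exists {q R : ℝ → ℝ} {B : ℝ} (H : Coef q R B) :
    ∃ y u m P : ℝ → ℝ → ℝ, Fam q R y u m P ∧ ∀ L, 0 ≤ L → ∀ Y U M Q : ℝ → ℝ,
      IsSol q R L Y U M Q → Y 0 = 0 → U 0 = 0 → U 1 = 0 →
      ∃ k : ℝ, ∀ x ∈ Icc (0:ℝ) 1, Y x = k * y L x ∧ U x = k * u L x ∧ M x = k * m L x ∧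
        Q x = k * P L x := by
  obtain ⟨y₁, u₁, m₁, P₁, cy₁, cu₁, cm₁, cP₁, h₁⟩ :=
    isSol_exists q R B H.qc H.Rc H.qB H.RB 1 0
  obtain ⟨y₂, u₂, m₂, P₂, cy₂, cu₂, cm₂, cP₂, h₂⟩ :=
    isSol_exists q R B H.qc H.Rc H.qB H.RB 0 1
  have hu1 : ∀ L, 0 ≤ L → 0 < u₁ L 1 := fun L hL => by
    obtain ⟨hs, e1, e2, e3, e4⟩ := h₁ L
    exact (hs.pos H.q0 H.R0 hL one_pos e1 e2 (by simp [e3]) (by simp [e4]) (by simp [e3])).2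
  have hu2 : ∀ L, 0 ≤ L → 0 < u₂ L 1 := fun L hL => by
    obtain ⟨hs, e1, e2, e3, e4⟩ := h₂ L
    exact (hs.pos H.q0 H.R0 hL one_pos e1 e2 (by simp [e3]) (by simp [e4]) (by simp [e4])).2
  have cu1 : Continuous (fun z : ℝ × ℝ => u₁ z.1 1) :=
    cu₁.comp (by fun_prop : Continuous fun z : ℝ × ℝ => (z.1, (1:ℝ)))
  have cu2 : Continuous (fun z : ℝ × ℝ => u₂ z.1 1) :=
    cu₂.comp (by fun_prop : Continuous fun z : ℝ × ℝ => (z.1, (1:ℝ)))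
  refine ⟨fun L x => u₂ L 1 * y₁ L x + (-u₁ L 1) * y₂ L x,
    fun L x => u₂ L 1 * u₁ L x + (-u₁ L 1) * u₂ L x,
    fun L x => u₂ L 1 * m₁ L x + (-u₁ L 1) * m₂ L x,
    fun L x => u₂ L 1 * P₁ L x + (-u₁ L 1) * P₂ L x, ?_, ?_⟩
  · refine ⟨(cu2.mul cy₁).add (cu1.neg.mul cy₂), (cu2.mul cu₁).add (cu1.neg.mul cu₂),
      (cu2.mul cm₁).add (cu1.neg.mul cm₂), (cu2.mul cP₁).add (cu1.neg.mul cP₂),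
      fun L => (h₁ L).1.comb (h₂ L).1 _ _, fun L => ?_, fun L => ?_, fun L => ?_, fun L hL => ?_,
      fun L hL => ?_⟩
    · simp [(h₁ L).2.1, (h₂ L).2.1]
    · simp [(h₁ L).2.2.1, (h₂ L).2.2.1]
    · ring
    · simpa [(h₁ L).2.2.2.1, (h₂ L).2.2.2.1] using hu2 L hL
    · simpa [(h₁ L).2.2.2.2, (h₂ L).2.2.2.2] using hu1 L hL
  · intro L hL Y U M Q hs hY hU hU1
    have hall := sys_unique q R B H.qB H.RB L (fun x => (Y x, U x, M x, Q x))
      (fun x => (M 0 * y₁ L x + Q 0 * y₂ L x, M 0 * u₁ L x + Q 0 * u₂ L x,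
        M 0 * m₁ L x + Q 0 * m₂ L x, M 0 * P₁ L x + Q 0 * P₂ L x))
      (fun x _ => (hs.vec x).hasDerivWithinAt)
      (fun x _ => (((h₁ L).1.comb (h₂ L).1 (M 0) (Q 0)).vec x).hasDerivWithinAt)
      (by
        obtain ⟨_, e1, e2, e3, e4⟩ := h₁ L
        obtain ⟨_, d1, d2, d3, d4⟩ := h₂ L
        simp [hY, hU, e1, e2, e3, e4, d1, d2, d3, d4])
    have h1 := hall (right_mem_Icc.2 zero_le_one)
    simp only [Prod.mk.injEq] at h1
    have h2 : M 0 * u₁ L 1 + Q 0 * u₂ L 1 = 0 := by rw [← h1.2.1, hU1]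
    have hp2 := hu2 L hL
    have hQ : Q 0 = M 0 / u₂ L 1 * (-u₁ L 1) := by field_simp; linarith
    have hM : M 0 = M 0 / u₂ L 1 * u₂ L 1 := by field_simp
    refine ⟨M 0 / u₂ L 1, fun x hx => ?_⟩
    have h3 := hall hx
    simp only [Prod.mk.injEq] at h3
    obtain ⟨a1, a2, a3, a4⟩ := h3
    rw [hQ] at a1 a2 a3 a4
    refine ⟨?_, ?_, ?_, ?_⟩
    · rw [a1]; nth_rw 1 [hM]; ring
    · rw [a2]; nth_rw 1 [hM]; ring
    · rw [a3]; nth_rw 1 [hM]; ring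
    · rw [a4]; nth_rw 1 [hM]; ring

lemma pos_box {h : ℝ × ℝ → ℝ} (hc : Continuous h) (L₀ x₀ : ℝ) (hp : 0 < h (L₀, x₀)) :
    ∃ δ > 0, ∀ L, |L - L₀| < δ → ∀ x, |x - x₀| < δ → 0 < h (L, x) := by
  have := hc.continuousAt.eventually (lt_mem_nhds hp)
  rw [Metric.nhds_basis_ball.eventually_iff] at this
  obtain ⟨δ, hδ, hb⟩ := this
  refine ⟨δ, hδ, fun L hL x hx => hb ?_⟩
  rw [Metric.mem_ball, Prod.dist_eq]
  exact max_lt hL hx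

lemma ev_abs_lt (L₀ δ : ℝ) (hδ : 0 < δ) : ∀ᶠ L in nhds L₀, |L - L₀| < δ :=
  Metric.ball_mem_nhds L₀ hδ

section FamLemmas

variable {q R : ℝ → ℝ} {B : ℝ} {y u m P : ℝ → ℝ → ℝ}

lemma Fam.near_zero (F : Fam q R y u m P) (H : Coef q R B) {L₀ : ℝ} (hL₀ : 0 ≤ L₀) :
    ∃ δ > 0, ∀ᶠ L in nhds L₀, ∀ x ∈ Ioc 0 δ, 0 < y L x := by
  obtain ⟨δ, hδ, hb⟩ := pos_box F.mc L₀ 0 (F.m0 L₀ hL₀)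
  refine ⟨δ, hδ, ?_⟩
  filter_upwards [ev_abs_lt L₀ δ hδ] with L hL x hx
  refine ((F.sol L).pos_chain H.q0 hx.1 (F.y0 L) (F.u0 L) fun t ht => hb L hL t ?_).1
  rw [sub_zero, abs_of_pos ht.1]
  exact ht.2.trans_le hx.2

lemma Fam.near_zero_le (F : Fam q R y u m P) (H : Coef q R B) {L₀ : ℝ} (hL₀ : 0 ≤ L₀) {c : ℝ}
    (hc : 0 < c) : ∃ δ > 0, δ < c ∧ ∀ᶠ L in nhds L₀, ∀ x ∈ Ioc 0 δ, 0 < y L x := by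
  obtain ⟨δ, hδ, hb⟩ := F.near_zero H hL₀
  refine ⟨min δ (c / 2), by positivity, (min_le_right _ _).trans_lt (by linarith), ?_⟩
  filter_upwards [hb] with L hL x hx
  exact hL x ⟨hx.1, hx.2.trans (min_le_left _ _)⟩

lemma Fam.contyL (F : Fam q R y u m P) (x : ℝ) : Continuous fun L => y L x :=
  F.yc.comp (by fun_prop : Continuous fun t : ℝ => (t, x))

lemma Fam.contPL (F : Fam q R y u m P) (x : ℝ) : Continuous fun L => P L x :=
  F.Pc.comp (by fun_prop : Continuous fun t : ℝ => (t, x))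

lemma Fam.count_generic (F : Fam q R y u m P) (H : Coef q R B) {L₀ : ℝ} (hL₀ : 0 ≤ L₀)
    (hy1 : y L₀ 1 ≠ 0) : ∀ᶠ L in nhds L₀, {x ∈ Ioo (0:ℝ) 1 | y L x = 0}.Finite ∧
      {x ∈ Ioo (0:ℝ) 1 | y L x = 0}.ncard = {x ∈ Ioo (0:ℝ) 1 | y L₀ x = 0}.ncard := by
  obtain ⟨δ, hδ, hδ1, hb⟩ := F.near_zero_le H hL₀ one_pos
  have hcount := zeros_count y u F.yc F.uc (fun L x => (F.sol L).hy x) L₀ δ 1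
    (hb.self_of_nhds δ ⟨hδ, le_rfl⟩).ne' hy1 (fun x hx h0 => by
      refine (F.sol L₀).simple H hL₀ (F.y0 L₀) (F.m0 L₀ hL₀).ne' (F.u1 L₀)
        ⟨hδ.trans_le hx.1, lt_of_le_of_ne hx.2 ?_⟩ h0
      rintro rfl
      exact hy1 h0)
  have hset : ∀ᶠ L in nhds L₀, {x ∈ Ioo (0:ℝ) 1 | y L x = 0} = {x ∈ Icc δ 1 | y L x = 0} := by
    filter_upwards [hb, (F.contyL 1).continuousAt.eventually_ne hy1] with L h1 h2
    ext x
    constructor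
    · rintro ⟨hx, h0⟩
      refine ⟨⟨?_, hx.2.le⟩, h0⟩
      by_contra hc
      exact (h1 x ⟨hx.1, (not_le.1 hc).le⟩).ne' h0
    · rintro ⟨hx, h0⟩
      refine ⟨⟨hδ.trans_le hx.1, lt_of_le_of_ne hx.2 ?_⟩, h0⟩
      rintro rfl
      exact h2 h0
  filter_upwards [hcount, hset] with L h1 h2
  rw [h2, hset.self_of_nhds]
  exact h1

lemma Fam.count_pole (F : Fam q R y u m P) (H : Coef q R B) {L₀ : ℝ} (hL₀ : 0 ≤ L₀)
    (hm1 : m L₀ 1 ≠ 0) (hy1 : y L₀ 1 = 0) : ∀ᶠ L in nhds L₀,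
      (m L₀ 1 * y L 1 < 0 → {x ∈ Ioo (0:ℝ) 1 | y L x = 0}.ncard =
        {x ∈ Ioo (0:ℝ) 1 | y L₀ x = 0}.ncard + 1) ∧
      (0 ≤ m L₀ 1 * y L 1 → {x ∈ Ioo (0:ℝ) 1 | y L x = 0}.ncard =
        {x ∈ Ioo (0:ℝ) 1 | y L₀ x = 0}.ncard) := by
  set ε := m L₀ 1 with hεd
  obtain ⟨δ₁, hδ₁, hb₁⟩ := pos_box (h := fun z => ε * m z.1 z.2) (continuous_const.mul F.mc) L₀ 1
    (mul_self_pos.2 hm1)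
  set c := max (1 - δ₁ / 2) (1 / 2) with hcd
  have hc1 : c < 1 := max_lt (by linarith) (by norm_num)
  have hc2 : 1 / 2 ≤ c := le_max_right _ _
  have hc3 : 1 - δ₁ / 2 ≤ c := le_max_left _ _
  obtain ⟨δ, hδ, hδc, hb⟩ := F.near_zero_le H hL₀ (show 0 < c by linarith)
  -- strict decrease near 1
  have hdec : ∀ L, |L - L₀| < δ₁ → ∀ x x', c ≤ x → x < x' → x' ≤ 1 → ε * y L x' < ε * y L x := by
    intro L hL x x' hx hxx hx'
    have hu : ∀ t, c ≤ t → t < 1 → ε * u L t < 0 := by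
      intro t ht ht1
      have := lt_of_hasDerivAt_pos (fun x => ((F.sol L).hu x).const_mul ε) ht1 (fun w hw => by
        have := hb₁ L hL w (by rw [abs_lt]; constructor <;> linarith [hw.1, hw.2])
        have h2 := mul_pos (H.q0 w) this
        dsimp only at h2
        linarith)
      simpa [F.u1 L] using this
    have := lt_of_hasDerivAt_pos (fun x => ((F.sol L).hy x).const_mul (-ε)) hxx (fun w hw => by
      have := hu w (by linarith [hw.1]) (by linarith [hw.2])
      linarith)
    linarith
  have hyc0 : 0 < ε * y L₀ c := by
    have := hdec L₀ (by simpa using hδ₁) c 1 le_rfl hc1 le_rfl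
    simpa [hy1] using this
  have hcount := zeros_count y u F.yc F.uc (fun L x => (F.sol L).hy x) L₀ δ c
    (hb.self_of_nhds δ ⟨hδ, le_rfl⟩).ne' (fun h => by simp [h] at hyc0) (fun x hx h0 =>
      (F.sol L₀).simple H hL₀ (F.y0 L₀) (F.m0 L₀ hL₀).ne' (F.u1 L₀)
        ⟨hδ.trans_le hx.1, hx.2.trans_lt hc1⟩ h0)
  have main : ∀ᶠ L in nhds L₀, (ε * y L 1 < 0 → {x ∈ Ioo (0:ℝ) 1 | y L x = 0}.ncard =
        {x ∈ Icc δ c | y L₀ x = 0}.ncard + 1) ∧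
      (0 ≤ ε * y L 1 → {x ∈ Ioo (0:ℝ) 1 | y L x = 0}.ncard =
        {x ∈ Icc δ c | y L₀ x = 0}.ncard) := by
    have hyce : ∀ᶠ L in nhds L₀, 0 < ε * y L c :=
      (continuous_const.mul (F.contyL c)).continuousAt.eventually (lt_mem_nhds hyc0)
    filter_upwards [hcount, hb, hyce, ev_abs_lt L₀ δ₁ hδ₁] with L h1 h2 h3 h4
    have hlow : ∀ x ∈ Ioo (0:ℝ) 1, y L x = 0 → x ≤ c → x ∈ Icc δ c := by
      intro x hx h0 hxc
      refine ⟨?_, hxc⟩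
      by_contra hc
      exact (h2 x ⟨hx.1, (not_le.1 hc).le⟩).ne' h0
    constructor
    · intro hneg
      obtain ⟨z, hz, hz0⟩ := intermediate_value_Ioo' hc1.le
        (f := fun x => ε * y L x)
        (continuous_const.mul (F.yc.comp (by fun_prop : Continuous fun t : ℝ => (L, t)))).continuousOn
        (show (0:ℝ) ∈ Ioo _ _ from ⟨hneg, h3⟩)
      have hz0' : y L z = 0 := (mul_eq_zero.1 hz0).resolve_left hm1
      have hset : {x ∈ Ioo (0:ℝ) 1 | y L x = 0} = insert z {x ∈ Icc δ c | y L x = 0} := by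
        ext x
        constructor
        · rintro ⟨hx, h0⟩
          by_cases hxc : x ≤ c
          · exact Or.inr ⟨hlow x hx h0 hxc, h0⟩
          · left
            rcases lt_trichotomy x z with h | h | h
            · have := hdec L h4 x z (not_le.1 hxc).le h hz.2.le
              simp [h0, hz0'] at this
            · exact h
            · have := hdec L h4 z x hz.1.le h hx.2.le
              simp [h0, hz0'] at this
        · rintro (rfl | ⟨hx, h0⟩)
          · exact ⟨⟨by linarith [hz.1], hz.2⟩, hz0'⟩
          · exact ⟨⟨hδ.trans_le hx.1, hx.2.trans_lt hc1⟩, h0⟩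
      rw [hset, Set.ncard_insert_of_notMem (fun h => absurd hz.1 (not_lt.2 h.1.2)) h1.1, h1.2]
    · intro hnn
      have hset : {x ∈ Ioo (0:ℝ) 1 | y L x = 0} = {x ∈ Icc δ c | y L x = 0} := by
        ext x
        constructor
        · rintro ⟨hx, h0⟩
          refine ⟨hlow x hx h0 ?_, h0⟩
          by_contra hxc
          have := hdec L h4 x 1 (not_le.1 hxc).le hx.2 le_rfl
          simp only [h0, mul_zero] at this
          linarith
        · rintro ⟨hx, h0⟩
          exact ⟨⟨hδ.trans_le hx.1, hx.2.trans_lt hc1⟩, h0⟩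
      rw [hset, h1.2]
  have hself := main.self_of_nhds.2 (by simp [hy1])
  rw [hself]
  exact main

lemma rolle {f f' : ℝ → ℝ} (h : ∀ x, HasDerivAt f (f' x) x) {a b : ℝ} (hab : a < b)
    (he : f a = f b) : ∃ c ∈ Ioo a b, f' c = 0 :=
  exists_hasDerivAt_eq_zero hab (fun x _ => (h x).continuousAt.continuousWithinAt) he
    (fun x _ => h x)

lemma Fam.count_at_zero (F : Fam q R y u m P) (H : Coef q R B) :
    {x ∈ Ioo (0:ℝ) 1 | y 0 x = 0} = ∅ := by
  rw [Set.eq_empty_iff_forall_notMem]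
  rintro a ⟨ha, h0⟩
  have hs := F.sol 0
  obtain ⟨c, hc, hc0⟩ := rolle hs.hy ha.1 ((F.y0 0).trans h0.symm)
  obtain ⟨d, hd, hd0⟩ := rolle hs.hu hc.1 ((F.u0 0).trans hc0.symm)
  obtain ⟨e, he, he0⟩ := rolle hs.hu (hc.2.trans ha.2) (hc0.trans (F.u1 0).symm)
  have hd1 := (mul_eq_zero.1 hd0).resolve_left (H.q0 d).ne'
  have he1 := (mul_eq_zero.1 he0).resolve_left (H.q0 e).ne'
  obtain ⟨w, hw, hw0⟩ := rolle hs.hm (hd.2.trans he.1) (hd1.trans he1.symm)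
  have hconst := is_const_of_deriv_eq_zero (f := P 0) (fun x => (hs.hP x).differentiableAt)
    (fun x => by rw [(hs.hP x).deriv]; ring) w 0
  have := F.P0 0 le_rfl
  linarith

lemma Fam.main_count (F : Fam q R y u m P) (H : Coef q R B) (β : ℝ) {L : ℝ} (hL : 0 ≤ L)
    (hf : P L 1 + L * β * y L 1 = 0) :
    {x ∈ Ioo (0:ℝ) 1 | y L x = 0}.Finite ∧ {x ∈ Ioo (0:ℝ) 1 | y L x = 0}.ncard =
      ({L | P L 1 + L * β * y L 1 = 0} ∩ Ioo 0 L).ncard := by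
  classical
  set f : ℝ → ℝ := fun L => P L 1 + L * β * y L 1 with hfd
  set g : ℝ → ℝ := fun L => y L 1 with hgd
  have hgc : Continuous g := F.contyL 1
  have hfc : Continuous f := (F.contPL 1).add ((continuous_id.mul continuous_const).mul (F.contyL 1))
  have hpole : ∀ L, 0 ≤ L → g L = 0 → 0 < m L 1 * f L := by
    intro L hL hg
    have := (F.sol L).double H hL (F.y0 L) (F.m0 L hL).ne' one_pos hg (F.u1 L)
    have hg' : y L 1 = 0 := hg
    simpa [hfd, hg'] using this
  have hfg0 : f 0 * g 0 < 0 := by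
    have h1 := (F.sol 0).energy0 H.qc (F.y0 0) (F.u0 0) (F.u1 0)
    have h2 := energy_pos H.qc H.q0 (F.sol 0).contm (F.m0 0 le_rfl).ne'
    simp only [hfd, hgd]
    rw [zero_mul, zero_mul, add_zero, h1]
    linarith
  set N : ℝ → ℕ := fun L => {x ∈ Ioo (0:ℝ) 1 | y L x = 0}.ncard with hN
  set s : ℝ → ℕ := fun L => if 0 < f L * g L ∨ g L = 0 then 1 else 0 with hs
  have hs1 : ∀ L, 0 < f L * g L → s L = 1 := fun L h => if_pos (Or.inl h)
  have hs1' : ∀ L, g L = 0 → s L = 1 := fun L h => if_pos (Or.inr h)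
  have hs0 : ∀ L, f L * g L ≤ 0 → g L ≠ 0 → s L = 0 := fun L h h' =>
    if_neg (by rintro (h1 | h1); exacts [absurd h1 (not_lt.2 h), h' h1])
  have hgreen : ∀ L₀ L, L * (f L₀ * g L) - L₀ * (f L * g L₀) =
      (L₀ - L) * ∫ x in (0:ℝ)..1, q x * m L₀ x * m L x := by
    intro L₀ L
    rw [← (F.sol L₀).green H.qc (F.sol L) (F.y0 _) (F.u0 _) (F.u1 _) (F.y0 _) (F.u0 _) (F.u1 _)]
    simp only [hfd, hgd]
    ring
  have hE : ∀ L₀, 0 ≤ L₀ → ∀ᶠ L in nhds L₀, 0 < ∫ x in (0:ℝ)..1, q x * m L₀ x * m L x := by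
    intro L₀ hL₀
    have hc : Continuous fun L => ∫ x in (0:ℝ)..1, q x * m L₀ x * m L x := by
      refine intervalIntegral.continuous_parametric_intervalIntegral_of_continuous' ?_ 0 1
      have h1 : Continuous fun z : ℝ × ℝ => q z.2 := H.qc.comp continuous_snd
      have h2 : Continuous fun z : ℝ × ℝ => m L₀ z.2 := (F.sol L₀).contm.comp continuous_snd
      exact (h1.mul h2).mul F.mc
    exact hc.continuousAt.eventually
      (lt_mem_nhds (energy_pos H.qc H.q0 (F.sol L₀).contm (F.m0 L₀ hL₀).ne'))
  have key := count_abstract (fun L => N L + s L) {L | f L = 0} (by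
      have h1 : N 0 = 0 := by simp only [hN, F.count_at_zero H, Set.ncard_empty]
      have h2 : s 0 = 0 := hs0 0 hfg0.le (fun h => by simp [h] at hfg0)
      simp [h1, h2]) (by
    intro L₀ hL₀
    by_cases hg0 : g L₀ = 0
    · -- pole
      have hmf := hpole L₀ hL₀ hg0
      have hf0 : f L₀ ≠ 0 := fun h => by simp [h] at hmf
      have hm1 : m L₀ 1 ≠ 0 := fun h => by simp [h] at hmf
      have hL₀' : 0 < L₀ := lt_of_le_of_ne hL₀ (by rintro rfl; simp [hg0] at hfg0)
      have hff : ∀ᶠ L in nhds L₀, 0 < f L * f L₀ :=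
        (hfc.mul continuous_const).continuousAt.eventually (lt_mem_nhds (mul_self_pos.2 hf0))
      filter_upwards [F.count_pole H hL₀ hm1 hg0, hE L₀ hL₀, hff, lt_mem_nhds hL₀'] with L h1 h2 h3 h4 _
      have hgr := hgreen L₀ L
      rw [hg0, mul_zero, mul_zero, sub_zero] at hgr
      have hfL : f L ≠ 0 := fun h => by simp [h] at h3
      have hsign : 0 < (m L₀ 1 * g L) * (f L₀ * g L) ∨ g L = 0 := by
        by_cases h : g L = 0
        · exact Or.inr h
        · left
          have : (m L₀ 1 * g L) * (f L₀ * g L) = (m L₀ 1 * f L₀) * (g L * g L) := by ring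
          rw [this]
          exact mul_pos hmf (mul_self_pos.2 h)
      have hsign2 : 0 < (f L * g L) * (f L₀ * g L) ∨ g L = 0 := by
        by_cases h : g L = 0
        · exact Or.inr h
        · left
          have : (f L * g L) * (f L₀ * g L) = (f L * f L₀) * (g L * g L) := by ring
          rw [this]
          exact mul_pos h3 (mul_self_pos.2 h)
      refine ⟨fun _ => hfL, fun hle => ?_, fun hlt => ⟨fun h => absurd h hf0, fun _ => ?_⟩⟩
      · rcases hle.lt_or_eq with hlt | rfl
        · have h5 : 0 < f L₀ * g L := by
            have : 0 < L * (f L₀ * g L) := by rw [hgr]; exact mul_pos (sub_pos.2 hlt) h2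
            exact (mul_pos_iff_of_pos_left h4).1 this
          have hgL : g L ≠ 0 := fun h => by simp [h] at h5
          have h6 := (mul_pos_iff_of_pos_right h5).1 (hsign.resolve_right hgL)
          have h7 := (mul_pos_iff_of_pos_right h5).1 (hsign2.resolve_right hgL)
          show N L + s L = N L₀ + s L₀
          rw [hs1 L h7, hs1' L₀ hg0, show N L = N L₀ from h1.2 h6.le]
        · rfl
      · have h5 : f L₀ * g L < 0 := by
          have : L * (f L₀ * g L) < 0 := by
            rw [hgr]; exact mul_neg_of_neg_of_pos (sub_neg.2 hlt) h2
          exact (pos_iff_neg_of_mul_neg this).1 h4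
        have hgL : g L ≠ 0 := fun h => by simp [h] at h5
        have h6 : m L₀ 1 * g L < 0 := (neg_iff_neg_of_mul_pos (hsign.resolve_right hgL)).2 h5
        have h7 : f L * g L < 0 := (neg_iff_neg_of_mul_pos (hsign2.resolve_right hgL)).2 h5
        show N L + s L = N L₀ + s L₀
        rw [hs0 L h7.le hgL, hs1' L₀ hg0, show N L = N L₀ + 1 from h1.1 h6]
    · have hgg : ∀ᶠ L in nhds L₀, 0 < g L * g L₀ :=
        (hgc.mul continuous_const).continuousAt.eventually (lt_mem_nhds (mul_self_pos.2 hg0))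
      by_cases hf0 : f L₀ = 0
      · have hL₀' : 0 < L₀ := lt_of_le_of_ne hL₀ (by rintro rfl; simp [hf0] at hfg0)
        filter_upwards [F.count_generic H hL₀ hg0, hE L₀ hL₀, hgg] with L h1 h2 h3 _
        have hgr := hgreen L₀ L
        rw [hf0, zero_mul, mul_zero, zero_sub] at hgr
        have hgL : g L ≠ 0 := fun h => by simp [h] at h3
        have hNL : N L = N L₀ := h1.2
        have hsL₀ : s L₀ = 0 := hs0 L₀ (by simp [hf0]) hg0
        have hcases : (L < L₀ → f L * g L₀ < 0) ∧ (L₀ < L → 0 < f L * g L₀) := by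
          constructor
          · intro hlt
            have : L₀ * (f L * g L₀) < 0 := by nlinarith [mul_pos (sub_pos.2 hlt) h2]
            exact (pos_iff_neg_of_mul_neg this).1 hL₀'
          · intro hlt
            have : 0 < L₀ * (f L * g L₀) := by nlinarith [mul_pos (sub_pos.2 hlt) h2]
            exact (mul_pos_iff_of_pos_left hL₀').1 this
        have hprod : 0 < (f L * g L) * (f L * g L₀) ∨ f L = 0 := by
          by_cases h : f L = 0
          · exact Or.inr h
          · left
            have : (f L * g L) * (f L * g L₀) = (f L * f L) * (g L * g L₀) := by ring
            rw [this]
            exact mul_pos (mul_self_pos.2 h) h3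
        refine ⟨fun hne hfL => ?_, fun hle => ?_, fun hlt => ⟨fun _ => ?_, fun h => absurd hf0 h⟩⟩
        · have hfL' : f L = 0 := hfL
          rcases lt_or_gt_of_ne hne with h | h
          · have := hcases.1 h; simp [hfL'] at this
          · have := hcases.2 h; simp [hfL'] at this
        · rcases hle.lt_or_eq with hlt | rfl
          · have h5 := hcases.1 hlt
            have h6 : f L * g L < 0 := (neg_iff_neg_of_mul_pos
              (hprod.resolve_right fun h => by simp [h] at h5)).2 h5
            show N L + s L = N L₀ + s L₀
            rw [hs0 L h6.le hgL, hsL₀, hNL]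
          · rfl
        · have h5 := hcases.2 hlt
          have h6 := (mul_pos_iff_of_pos_right h5).1
            (hprod.resolve_right fun h => by simp [h] at h5)
          show N L + s L = N L₀ + s L₀ + 1
          rw [hs1 L h6, hsL₀, hNL]
      · have hff : ∀ᶠ L in nhds L₀, 0 < f L * f L₀ :=
          (hfc.mul continuous_const).continuousAt.eventually (lt_mem_nhds (mul_self_pos.2 hf0))
        filter_upwards [F.count_generic H hL₀ hg0, hff, hgg] with L h1 h2 h3 _
        have hfL : f L ≠ 0 := fun h => by simp [h] at h2
        have hgL : g L ≠ 0 := fun h => by simp [h] at h3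
        have hNL : N L = N L₀ := h1.2
        have hprod : 0 < (f L * g L) * (f L₀ * g L₀) := by
          have : (f L * g L) * (f L₀ * g L₀) = (f L * f L₀) * (g L * g L₀) := by ring
          rw [this]; exact mul_pos h2 h3
        have hss : s L = s L₀ := by
          rcases lt_or_gt_of_ne (mul_ne_zero hf0 hg0) with h | h
          · rw [hs0 L₀ h.le hg0, hs0 L ((neg_iff_neg_of_mul_pos hprod).2 h).le hgL]
          · rw [hs1 L₀ h, hs1 L ((mul_pos_iff_of_pos_right h).1 hprod)]
        have hC : N L + s L = N L₀ + s L₀ := by rw [hNL, hss]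
        exact ⟨fun _ => hfL, fun _ => hC, fun _ => ⟨fun h => absurd h hf0, fun _ => hC⟩⟩)
  have hgL : g L ≠ 0 := fun h => by
    have := hpole L hL h
    have hf' : f L = 0 := hf
    simp [hf'] at this
  have hfin := (F.count_generic H hL hgL).self_of_nhds.1
  refine ⟨hfin, ?_⟩
  have h1 := (key L hL).2
  have h2 : s L = 0 := hs0 L (by
    have hf' : f L = 0 := hf
    simp [hf']) hgL
  have h3 : {L | f L = 0} ∩ Ico 0 L = {L | f L = 0} ∩ Ioo 0 L := by
    ext x
    constructor
    · rintro ⟨hx1, hx2⟩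
      refine ⟨hx1, lt_of_le_of_ne hx2.1 ?_, hx2.2⟩
      rintro rfl
      have hx1' : f 0 = 0 := hx1
      simp [hx1'] at hfg0
    · rintro ⟨hx1, hx2⟩
      exact ⟨hx1, hx2.1.le, hx2.2⟩
  rw [h3] at h1
  simp only [h2, add_zero] at h1
  exact h1.symm

end FamLemmas

lemma Dv_hasDeriv {f : ℝ → ℝ} (hf : ContDiffOn ℝ 2 f (Icc 0 1)) :
    (∀ x ∈ Icc (0:ℝ) 1, HasDerivWithinAt f (Dv f x) (Icc 0 1) x) ∧
    (∀ x ∈ Icc (0:ℝ) 1, HasDerivWithinAt (Dv f) (Dv (Dv f) x) (Icc 0 1) x) := by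
  constructor
  · intro x hx
    exact (hf.differentiableOn (by norm_num) x hx).hasDerivWithinAt
  · intro x hx
    have : ContDiffOn ℝ 1 (Dv f) (Icc 0 1) :=
      hf.derivWithin (uniqueDiffOn_Icc one_pos) (by norm_num)
    exact (this.differentiableOn (by norm_num) x hx).hasDerivWithinAt

lemma Dv_of_eqOn {f g g' : ℝ → ℝ} (hfg : EqOn f g (Icc 0 1))
    (hg : ∀ x, HasDerivAt g (g' x) x) : EqOn (Dv f) g' (Icc 0 1) := by
  intro x hx
  have : HasDerivWithinAt f (g' x) (Icc 0 1) x :=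
    (hg x).hasDerivWithinAt.congr hfg (hfg hx)
  exact this.derivWithin (uniqueDiffOn_Icc one_pos x hx)

lemma contDiff_two_of {f f' f'' : ℝ → ℝ} (h1 : ∀ x, HasDerivAt f (f' x) x)
    (h2 : ∀ x, HasDerivAt f' (f'' x) x) (hc : Continuous f'') : ContDiff ℝ 2 f := by
  have e1 : deriv f = f' := funext fun x => (h1 x).deriv
  have e2 : deriv f' = f'' := funext fun x => (h2 x).deriv
  have c1 : ContDiff ℝ 1 f' :=
    contDiff_one_iff_deriv.2 ⟨fun x => (h2 x).differentiableAt, e2 ▸ hc⟩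
  rw [show (2 : WithTop ℕ∞) = 1 + 1 by norm_num, contDiff_succ_iff_deriv]
  exact ⟨fun x => (h1 x).differentiableAt, by simp, e1 ▸ c1⟩

lemma coef_exists (p r : ℝ → ℝ) (c : ℝ)
    (hpc : ContinuousOn p (Icc 0 1)) (hrc : ContinuousOn r (Icc 0 1))
    (hp : ∀ x ∈ Icc (0:ℝ) 1, 0 < p x) (hr : ∀ x ∈ Icc (0:ℝ) 1, 0 < r x) (hc : c < 0) :
    ∃ q R B, Coef q R B ∧ ∀ x ∈ Icc (0:ℝ) 1, q x * p x = 1 ∧ R x = -c * r x := by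
  have ext : ∀ g : ℝ → ℝ, ContinuousOn g (Icc 0 1) → (∀ x ∈ Icc (0:ℝ) 1, 0 < g x) →
      ∃ (q : ℝ → ℝ) (B : ℝ), Continuous q ∧ (∀ x, 0 < q x) ∧ (∀ x, |q x| ≤ B) ∧
        ∀ x ∈ Icc (0:ℝ) 1, q x = g x := by
    intro g hg hg0
    obtain ⟨B, hB⟩ := isCompact_Icc.exists_bound_of_continuousOn hg
    refine ⟨IccExtend zero_le_one ((Icc (0:ℝ) 1).domRestrict g), B,
      hg.domRestrict.Icc_extend', fun x => ?_, fun x => ?_, fun x hx => ?_⟩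
    · exact hg0 _ (projIcc 0 1 zero_le_one x).2
    · exact hB _ (projIcc 0 1 zero_le_one x).2
    · rw [IccExtend_of_mem _ _ hx]; rfl
  obtain ⟨q, B1, q1, q2, q3, q4⟩ := ext (fun x => (p x)⁻¹)
    (hpc.inv₀ fun x hx => (hp x hx).ne') (fun x hx => inv_pos.2 (hp x hx))
  obtain ⟨R, B2, R1, R2, R3, R4⟩ := ext (fun x => -c * r x)
    (continuousOn_const.mul hrc) (fun x hx => mul_pos (by linarith) (hr x hx))
  refine ⟨q, R, max B1 B2, ⟨q1, R1, q2, R2, fun x => (q3 x).trans (le_max_left _ _),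
    fun x => (R3 x).trans (le_max_right _ _)⟩, fun x hx => ⟨?_, R4 x hx⟩⟩
  rw [q4 x hx]
  exact inv_mul_cancel₀ (hp x hx).ne'

/-- Classical solutions with `y(0) = y'(0) = 0` come from global solutions of the system. -/
lemma solT_isSol {p r q R : ℝ → ℝ} {c B lam : ℝ} (H : Coef q R B)
    (hqR : ∀ x ∈ Icc (0:ℝ) 1, q x * p x = 1 ∧ R x = -c * r x) {y : ℝ → ℝ}
    (hy : SolT p r c lam y) (h0 : y 0 = 0) (h1 : Dv y 0 = 0) :
    ∃ Y U M Q, IsSol q R (-lam) Y U M Q ∧ Y 0 = 0 ∧ U 0 = 0 ∧ ∀ x ∈ Icc (0:ℝ) 1,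
      y x = Y x ∧ Dv y x = U x ∧ Dv (fun t => p t * Dv (Dv y) t) x = Q x := by
  obtain ⟨c1, c2, heq⟩ := hy
  obtain ⟨d1, d2⟩ := Dv_hasDeriv c1
  obtain ⟨d3, d4⟩ := Dv_hasDeriv c2
  set M0 : ℝ → ℝ := fun t => p t * Dv (Dv y) t with hM0
  obtain ⟨Y, U, M, Q, -, -, -, -, hs⟩ :=
    isSol_exists q R B H.qc H.Rc H.qB H.RB (M0 0) (Dv M0 0)
  obtain ⟨S, s1, s2, s3, s4⟩ := hs (-lam)
  have hqm : ∀ x ∈ Icc (0:ℝ) 1, q x * M0 x = Dv (Dv y) x := fun x hx => by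
    have := (hqR x hx).1
    simp only [hM0]
    rw [← mul_assoc, this, one_mul]
  have := sys_unique q R B H.qB H.RB (-lam) (fun x => (y x, Dv y x, M0 x, Dv M0 x))
    (fun x => (Y (-lam) x, U (-lam) x, M (-lam) x, Q (-lam) x)) (fun x hx => by
      rw [sysA_apply]
      refine (d1 x hx).prodMk (HasDerivWithinAt.prodMk ?_ ((d3 x hx).prodMk ?_))
      · simpa only [hqm x hx] using d2 x hx
      · have h2 := heq x hx
        have h3 := hqm x hx
        have h4 := (hqR x hx).2
        have h5 : Dv (Dv M0) x = -lam * (q x * M0 x + R x * y x) := by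
          rw [h3, h4]
          linarith
        have h6 := d4 x hx
        rw [h5] at h6
        exact h6) (fun x hx => (S.vec x).hasDerivWithinAt) (by
      simp [h0, h1, s1, s2, s3, s4])
  refine ⟨_, _, _, _, S, s1, s2, fun x hx => ?_⟩
  have := this hx
  simp only [Prod.mk.injEq] at this
  exact ⟨this.1, this.2.1, this.2.2.2⟩

/-- Global solutions of the system give eigenvalues. -/
lemma eig_of_isSol {p r q R : ℝ → ℝ} {c B L alpha : ℝ} (H : Coef q R B)
    (hqR : ∀ x ∈ Icc (0:ℝ) 1, q x * p x = 1 ∧ R x = -c * r x) {y u m P : ℝ → ℝ}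
    (hs : IsSol q R L y u m P) (h0 : y 0 = 0) (h1 : u 0 = 0) (h2 : u 1 = 0) (hm : m 0 ≠ 0)
    (hf : P 1 + L * (-alpha) * y 1 = 0) : EigT2 p r c alpha (-L) := by
  have m0 : (0:ℝ) ∈ Icc (0:ℝ) 1 := by simp
  have m1 : (1:ℝ) ∈ Icc (0:ℝ) 1 := by simp
  have cm : Continuous m := continuous_iff_continuousAt.2 fun x => (hs.hm x).continuousAt
  have cy : Continuous y := continuous_iff_continuousAt.2 fun x => (hs.hy x).continuousAt
  have e1 : EqOn (Dv y) u (Icc 0 1) := Dv_of_eqOn (fun x _ => rfl) hs.hy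
  have e2 : EqOn (Dv (Dv y)) (fun x => q x * m x) (Icc 0 1) := Dv_of_eqOn e1 hs.hu
  have e3 : EqOn (fun t => p t * Dv (Dv y) t) m (Icc 0 1) := fun x hx => by
    have := (hqR x hx).1
    simp only [e2 hx]
    linear_combination m x * this
  have e4 : EqOn (Dv (fun t => p t * Dv (Dv y) t)) P (Icc 0 1) := Dv_of_eqOn e3 hs.hm
  have e5 := Dv_of_eqOn e4 hs.hP
  refine ⟨y, ⟨?_, ?_, ?_⟩, ?_, h0, by rw [e1 m0, h1], by rw [e1 m1, h2], ?_⟩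
  · exact (contDiff_two_of hs.hy hs.hu (H.qc.mul cm)).contDiffOn
  · exact (contDiff_two_of hs.hm hs.hP
      (continuous_const.mul ((H.qc.mul cm).add (H.Rc.mul cy)))).contDiffOn.congr e3
  · intro x hx
    rw [e5 hx, e2 hx]
    simp only [(hqR x hx).2]
    ring
  · by_contra hcon
    have hz : EqOn y (fun _ => 0) (Icc 0 1) := fun x hx => by
      by_contra h
      exact hcon ⟨x, hx, h⟩
    have f1 : EqOn (Dv y) (fun _ => 0) (Icc 0 1) := Dv_of_eqOn hz (fun x => hasDerivAt_const x 0)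
    have f2 : EqOn (Dv (Dv y)) (fun _ => 0) (Icc 0 1) :=
      Dv_of_eqOn f1 (fun x => hasDerivAt_const x 0)
    have := e3 m0
    simp only [f2 m0, mul_zero] at this
    exact hm this.symm
  · rw [e4 m1]
    linarith

theorem stmt_16 (p r : ℝ → ℝ) (c alpha : ℝ) (n : ℕ) (lam : ℝ) (y : ℝ → ℝ)
    (hpc : ContinuousOn p (Icc 0 1)) (hrc : ContinuousOn r (Icc 0 1))
    (hp : ∀ x ∈ Icc (0:ℝ) 1, 0 < p x) (hr : ∀ x ∈ Icc (0:ℝ) 1, 0 < r x)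
    (hc : c < 0) (halpha : alpha ≤ 0) (hn : 1 ≤ n) (hlam : lam < 0)
    (heig : EigT2 p r c alpha lam)
    (hfin : {μ : ℝ | EigT2 p r c alpha μ ∧ lam < μ ∧ μ < 0}.Finite)
    (hcard : {μ : ℝ | EigT2 p r c alpha μ ∧ lam < μ ∧ μ < 0}.ncard = n - 1)
    (hy : SolT p r c lam y) (hnt : Nontriv y) (hbc : BC2 p lam alpha y) :
    {x ∈ Ioo (0:ℝ) 1 | y x = 0}.Finite ∧
      {x ∈ Ioo (0:ℝ) 1 | y x = 0}.ncard = n - 1 ∧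
      ∀ a ∈ Ioo (0:ℝ) 1, y a = 0 → Dv y a ≠ 0 := by

  obtain ⟨q, R, B, H, hqR⟩ := coef_exists p r c hpc hrc hp hr hc
  obtain ⟨φ, u, m, P, F, hF⟩ := fam_exists H
  have m1 : (1:ℝ) ∈ Icc (0:ℝ) 1 := by simp
  have key : ∀ μ < 0, ∀ z, SolT p r c μ z → Nontriv z → BC2 p μ alpha z →
      P (-μ) 1 + (-μ) * (-alpha) * φ (-μ) 1 = 0 ∧ ∃ k : ℝ, k ≠ 0 ∧ ∀ x ∈ Icc (0:ℝ) 1,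
        z x = k * φ (-μ) x ∧ Dv z x = k * u (-μ) x := by
    intro μ hμ z hz hzn hzb
    obtain ⟨b1, b2, b3, b4⟩ := hzb
    obtain ⟨Y, U, M, Q, S, S0, S1, hS⟩ := solT_isSol H hqR hz b1 b2
    obtain ⟨k, hk⟩ := hF (-μ) (by linarith) Y U M Q S S0 S1 ((hS 1 m1).2.1 ▸ b3)
    have hk0 : k ≠ 0 := by
      rintro rfl
      obtain ⟨x, hx, hne⟩ := hzn
      apply hne
      rw [(hS x hx).1, (hk x hx).1, zero_mul]
    refine ⟨?_, k, hk0, fun x hx => ⟨by rw [(hS x hx).1, (hk x hx).1],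
      by rw [(hS x hx).2.1, (hk x hx).2.1]⟩⟩
    rw [(hS 1 m1).1, (hS 1 m1).2.2, (hk 1 m1).1, (hk 1 m1).2.2.2] at b4
    apply mul_left_cancel₀ hk0
    linarith
  obtain ⟨hf, k, hk0, hk⟩ := key lam hlam y hy hnt hbc
  have hL : 0 ≤ -lam := by linarith
  obtain ⟨z1, z2⟩ := F.main_count H (-alpha) hL hf
  have hset : {x ∈ Ioo (0:ℝ) 1 | y x = 0} = {x ∈ Ioo (0:ℝ) 1 | φ (-lam) x = 0} := by
    ext x
    refine and_congr_right fun hx => ?_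
    rw [(hk x (Ioo_subset_Icc_self hx)).1]
    simp [hk0]
  have himg : {μ : ℝ | EigT2 p r c alpha μ ∧ lam < μ ∧ μ < 0} =
      (fun L : ℝ => -L) '' ({L | P L 1 + L * (-alpha) * φ L 1 = 0} ∩ Ioo 0 (-lam)) := by
    ext μ
    constructor
    · rintro ⟨⟨z, hz, hzn, hzb⟩, h1, h2⟩
      exact ⟨-μ, ⟨(key μ h2 z hz hzn hzb).1, by linarith, by linarith⟩, neg_neg μ⟩
    · rintro ⟨L, ⟨h1, h2, h3⟩, rfl⟩
      refine ⟨eig_of_isSol H hqR (F.sol L) (F.y0 L) (F.u0 L) (F.u1 L) (F.m0 L h2.le).ne' h1, ?_, ?_⟩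
      · show lam < -L
        linarith
      · show -L < 0
        linarith
  rw [himg, ncard_image_of_injective _ neg_injective] at hcard
  refine ⟨hset ▸ z1, by rw [hset, z2, hcard], fun a ha hya => ?_⟩
  have hka := hk a (Ioo_subset_Icc_self ha)
  rw [hka.2]
  refine mul_ne_zero hk0 ((F.sol (-lam)).simple H hL (F.y0 _) (F.m0 _ hL).ne' (F.u1 _) ha ?_)
  rw [hka.1] at hya
  exact (mul_eq_zero.1 hya).resolve_left hk0
end

section
/- Let p, r : [0,1] → ℝ be continuous with p(x) > 0 and r(x) > 0 for all x ∈ [0,1], and let c > 0 and α ≥ 0. Suppose λ > 0 is an eigenvalue of the problem (E_T) with boundary conditions (BC2) such that no μ with 0 < μ < λ is an eigenvalue of that problem. Then (i) any two nontrivial classical solutions at λ are linearly dependent, and (ii) every nontrivial classical solution y at λ satisfies y(x) ≠ 0 for all x ∈ (0,1) (the first eigenfunction is of constant sign on (0,1)). -/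
open Set

theorem abs_unit {X : Type*} [TopologicalSpace X] [CompactSpace X]
    (A : C(X, ℝ) →L[ℝ] C(X, ℝ)) (hA : IsCompactOperator A) (mu : ℝ)
    (h : ∀ u : C(X, ℝ), u = mu • A u → u = 0) : IsUnit (1 - mu • A) := by
  by_cases hm : mu = 0
  · subst hm
    have : (1 - (0:ℝ) • A) = 1 := by
      ext f x; simp [sub_apply, smul_apply]
    rw [this]; exact isUnit_one
  rcases hA.hasEigenvalue_or_mem_resolventSet (μ := mu⁻¹) (inv_ne_zero hm) with h1 | h1
  · obtain ⟨u, hu⟩ := h1.exists_hasEigenvector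
    exfalso
    apply hu.2
    apply h
    have := hu.apply_eq_smul
    have h2 : A u = mu⁻¹ • u := this
    rw [h2, smul_smul, mul_inv_cancel₀ hm, one_smul]
  · have h2 : IsUnit (algebraMap ℝ (C(X, ℝ) →L[ℝ] C(X, ℝ)) mu⁻¹ - A) := h1
    have h3 : (1 - mu • A) = algebraMap ℝ (C(X, ℝ) →L[ℝ] C(X, ℝ)) mu *
        (algebraMap ℝ (C(X, ℝ) →L[ℝ] C(X, ℝ)) mu⁻¹ - A) := by
      rw [mul_sub, ← map_mul, mul_inv_cancel₀ hm, map_one]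
      ext f x; simp [sub_apply, smul_apply, Algebra.algebraMap_eq_smul_one]
    rw [h3]
    exact ((IsUnit.mk0 mu hm).map _).mul h2

theorem abs_key {X : Type*} [TopologicalSpace X] [CompactSpace X] [Nonempty X]
    (A : C(X, ℝ) →L[ℝ] C(X, ℝ)) (hA : IsCompactOperator A)
    (hpos : ∀ f : C(X, ℝ), (∀ x, 0 ≤ f x) → ∀ x, 0 ≤ A f x)
    (m : ℝ) (hm : 0 ≤ m)
    (hno : ∀ mu, 0 ≤ mu → mu ≤ m → ∀ u : C(X, ℝ), u = mu • A u → u = 0)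
    (v : C(X, ℝ)) (hv : ∀ x, v x ≤ m * A v x) : ∀ x, v x ≤ 0 := by
  let z : ℝ → C(X, ℝ) := fun mu => Ring.inverse (1 - mu • A) 1
  have hz : ∀ mu ∈ Icc 0 m, z mu = 1 + mu • A (z mu) := by
    intro mu hmu
    have hu := abs_unit A hA mu (hno mu hmu.1 hmu.2)
    have := congrArg (fun B : C(X, ℝ) →L[ℝ] C(X, ℝ) => B 1) (Ring.mul_inverse_cancel _ hu)
    simp only [mul_apply_eq_comp, one_apply_eq_self, sub_apply, smul_apply] at this
    exact sub_eq_iff_eq_add.1 this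
  have hzc : ∀ mu ∈ Icc 0 m, ContinuousAt z mu := by
    intro mu hmu
    obtain ⟨U, hU⟩ := abs_unit A hA mu (hno mu hmu.1 hmu.2)
    have h1 := NormedRing.inverse_continuousAt (R := C(X, ℝ) →L[ℝ] C(X, ℝ)) U
    rw [hU] at h1
    have h2 : ContinuousAt (fun mu : ℝ => Ring.inverse (1 - mu • A)) mu :=
      ContinuousAt.comp (f := fun mu : ℝ => 1 - mu • A) h1 (by fun_prop)
    exact h2.clm_apply continuousAt_const
  have hz1 : ∀ mu ∈ Icc 0 m, (∀ x, 0 ≤ z mu x) → ∀ x, 1 ≤ z mu x := by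
    intro mu hmu h x
    have h1 := hpos _ h x
    rw [hz mu hmu]
    simp only [ContinuousMap.add_apply, ContinuousMap.one_apply, ContinuousMap.smul_apply, smul_eq_mul]
    nlinarith [mul_nonneg hmu.1 h1]
  have hmem : ∀ mu ∈ Icc 0 m, ∀ x, 0 ≤ z mu x := by
    have hcl : IsClosed ({mu | ∀ x, 0 ≤ z mu x} ∩ Icc 0 m) := by
      have hs : ContinuousOn z (Icc 0 m) := fun mu hmu => (hzc mu hmu).continuousWithinAt
      have hC : IsClosed {f : C(X, ℝ) | ∀ x, 0 ≤ f x} := by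
        simp only [ofPred_forall]
        exact isClosed_iInter fun x => isClosed_le continuous_const (by fun_prop)
      have := hs.preimage_isClosed_of_isClosed isClosed_Icc hC
      rw [inter_comm] at this
      exact this
    have h0 : (0 : ℝ) ∈ {mu | ∀ x, 0 ≤ z mu x} := by
      intro x
      rw [hz 0 ⟨le_rfl, hm⟩]; simp
    refine hcl.Icc_subset_of_forall_mem_nhdsWithin h0 ?_
    rintro mu ⟨h1, h2⟩
    have hmu : mu ∈ Icc 0 m := ⟨h2.1, h2.2.le⟩
    have h3 := hz1 mu hmu h1
    have h4 := (Metric.continuousAt_iff'.1 (hzc mu hmu)) 1 one_pos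
    apply nhdsWithin_le_nhds
    filter_upwards [h4] with nu hnu x
    have h5 := (ContinuousMap.dist_apply_le_dist (f := z nu) (g := z mu) x)
    rw [Real.dist_eq] at h5
    have := abs_lt.1 (h5.trans_lt hnu)
    linarith [h3 x]
  have hM : m ∈ Icc 0 m := ⟨hm, le_rfl⟩
  have hzM := hz1 m hM (hmem m hM)
  set Z := z m with hZ
  have hcont : Continuous fun x => v x / Z x :=
    v.continuous.div Z.continuous fun x => by linarith [hzM x]
  obtain ⟨x0, -, hx0⟩ := isCompact_univ.exists_isMaxOn univ_nonempty hcont.continuousOn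
  by_contra! hcon
  obtain ⟨x1, hx1⟩ := hcon
  set t := v x0 / Z x0 with ht
  have hle : ∀ x, v x / Z x ≤ t := fun x => hx0 (mem_univ x)
  have htpos : 0 < t := lt_of_lt_of_le (div_pos hx1 (by linarith [hzM x1])) (hle x1)
  have hd : ∀ x, 0 ≤ (t • Z - v) x := by
    intro x
    have := (div_le_iff₀ (by linarith [hzM x])).1 (hle x)
    simp; linarith
  have h6 := hpos _ hd x0
  have h7 := congrArg (fun f : C(X, ℝ) => f x0) (hz m hM)
  simp only [← hZ, map_sub, map_smul, ContinuousMap.add_apply, ContinuousMap.one_apply, ContinuousMap.smul_apply, ContinuousMap.sub_apply, smul_eq_mul] at h6 h7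
  have h8 : v x0 = t * Z x0 := by rw [ht, div_mul_cancel₀]; linarith [hzM x0]
  have h9 := hv x0
  have := mul_nonneg hm h6
  nlinarith

abbrev EE := C(Icc (0:ℝ) 1, ℝ)

noncomputable def ev (f : EE) : ℝ → ℝ := fun t => f (projIcc 0 1 zero_le_one t)

theorem ev_cont (f : EE) : Continuous (ev f) := f.continuous.comp continuous_projIcc

theorem ev_ii (f : EE) (a b : ℝ) : IntervalIntegrable (ev f) MeasureTheory.volume a b :=
  (ev_cont f).intervalIntegrable a b

theorem ev_of_mem (f : EE) (t : ℝ) (h : t ∈ Icc (0:ℝ) 1) : ev f t = f ⟨t, h⟩ := by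
  rw [ev, projIcc_of_mem _ h]

theorem ev_coe (f : EE) (t : Icc (0:ℝ) 1) : ev f t = f t := ev_of_mem f t t.2

theorem ev_norm (f : EE) (t : ℝ) : ‖ev f t‖ ≤ ‖f‖ := f.norm_coe_le_norm _

noncomputable def JL : EE →L[ℝ] EE :=
  LinearMap.mkContinuous
    { toFun := fun f => ⟨fun x => ∫ t in (0:ℝ)..x, ev f t,
        (intervalIntegral.continuous_primitive (ev_ii f) 0).comp continuous_subtype_val⟩
      map_add' := by
        intro f g; ext x
        exact intervalIntegral.integral_add (ev_ii f _ _) (ev_ii g _ _)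
      map_smul' := by
        intro a f; ext x
        exact intervalIntegral.integral_const_mul a (ev f) } 1 (by
    intro f
    rw [ContinuousMap.norm_le _ (by positivity)]
    intro x
    have := intervalIntegral.norm_integral_le_of_norm_le_const (a := 0) (b := (x:ℝ)) (f := ev f)
      (C := ‖f‖) (fun t _ => ev_norm f t)
    refine this.trans ?_
    rw [sub_zero, abs_of_nonneg x.2.1, one_mul]
    nlinarith [x.2.2, norm_nonneg f])

theorem JL_apply (f : EE) (x : Icc (0:ℝ) 1) : JL f x = ∫ t in (0:ℝ)..x, ev f t := rfl

noncomputable def K1 : EE →L[ℝ] EE :=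
  LinearMap.mkContinuous
    { toFun := fun f => ContinuousMap.const _ (f 1)
      map_add' := by intro f g; rfl
      map_smul' := by intro a f; rfl } 1 (by
    intro f
    rw [ContinuousMap.norm_le _ (by positivity), one_mul]
    intro x
    exact f.norm_coe_le_norm _)

theorem K1_apply (f : EE) (x : Icc (0:ℝ) 1) : K1 f x = f 1 := rfl

theorem JL_compact : IsCompactOperator JL := by
  have h := (isCompactOperator_iff_isCompact_closure_image_closedBall (𝕜₁ := ℝ) (𝕜₂ := ℝ) (σ₁₂ := RingHom.id ℝ)
    (JL : EE →ₗ[ℝ] EE) one_pos)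
  refine h.2 ?_
  let e := BoundedContinuousFunction.mkOfCompact (α := Icc (0:ℝ) 1) (β := ℝ)
  let I := ContinuousMap.isometryEquivBoundedOfCompact (Icc (0:ℝ) 1) ℝ
  set S := ((JL : EE →ₗ[ℝ] EE) '' Metric.closedBall 0 1) with hS
  have h1 : IsCompact (closure (I '' S)) := by
    refine BoundedContinuousFunction.arzela_ascoli (Metric.closedBall (0:ℝ) 1) (isCompact_closedBall _ _) _ ?_ ?_
    · rintro _ x ⟨_, ⟨f, hf, rfl⟩, rfl⟩
      rw [mem_closedBall_zero_iff] at hf ⊢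
      have h2 : ‖JL f‖ ≤ 1 * ‖f‖ := JL.le_of_opNorm_le (LinearMap.mkContinuous_norm_le _ zero_le_one _) f
      exact ((JL f).norm_coe_le_norm x).trans (by linarith)
    · refine UniformEquicontinuous.equicontinuous ?_
      refine Metric.uniformEquicontinuous_of_continuity_modulus (fun d => d) Filter.tendsto_id _ ?_
      rintro x y ⟨_, ⟨_, ⟨f, hf, rfl⟩, rfl⟩⟩
      rw [mem_closedBall_zero_iff] at hf
      change dist (JL f x) (JL f y) ≤ dist x y
      rw [JL_apply, JL_apply, dist_comm, dist_eq_norm, intervalIntegral.integral_interval_sub_left (ev_ii _ _ _) (ev_ii _ _ _)]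
      refine (intervalIntegral.norm_integral_le_of_norm_le_const (C := 1) (fun t _ => (ev_norm f t).trans hf)).trans ?_
      rw [one_mul, dist_comm]; exact le_rfl
  have h2 : closure (I '' S) = I '' closure S := (I.toHomeomorph.image_closure S).symm
  rw [h2] at h1
  exact I.toHomeomorph.isCompact_image.1 h1

noncomputable def JR : EE →L[ℝ] EE := K1 ∘L JL - JL

theorem JR_apply (f : EE) (x : Icc (0:ℝ) 1) : JR f x = ∫ t in (x:ℝ)..1, ev f t := by
  have : JR f x = JL f 1 - JL f x := rfl
  rw [this, JL_apply, JL_apply, intervalIntegral.integral_interval_sub_left (ev_ii _ _ _) (ev_ii _ _ _)]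
  rfl

theorem JR_compact : IsCompactOperator JR := (JL_compact.clm_comp K1).sub JL_compact

noncomputable def TT (r : EE) (c α : ℝ) : EE →L[ℝ] EE :=
  ContinuousLinearMap.id ℝ EE + α • (K1 ∘L JL) + c • (JR ∘L (ContinuousLinearMap.mul ℝ EE r) ∘L JL)

theorem TT_apply (r : EE) (c α : ℝ) (u : EE) (x : Icc (0:ℝ) 1) :
    TT r c α u x = u x + α * JL u 1 + c * JR (r * JL u) x := rfl

noncomputable def GG (P Q : EE) (k : ℝ) : EE →L[ℝ] EE :=
  k • ((ContinuousLinearMap.mul ℝ EE Q) ∘L JL ∘L (ContinuousLinearMap.mul ℝ EE P) +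
    (ContinuousLinearMap.mul ℝ EE P) ∘L JR ∘L (ContinuousLinearMap.mul ℝ EE Q))

theorem GG_apply (P Q : EE) (k : ℝ) (f : EE) (x : Icc (0:ℝ) 1) :
    GG P Q k f x = k * (Q x * JL (P * f) x + P x * JR (Q * f) x) := rfl

theorem GG_compact (P Q : EE) (k : ℝ) : IsCompactOperator (GG P Q k) := by
  have h1 : IsCompactOperator ((ContinuousLinearMap.mul ℝ EE Q) ∘L JL ∘L (ContinuousLinearMap.mul ℝ EE P)) :=
    (JL_compact.comp_clm (ContinuousLinearMap.mul ℝ EE P)).clm_comp (ContinuousLinearMap.mul ℝ EE Q)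
  have h2 : IsCompactOperator ((ContinuousLinearMap.mul ℝ EE P) ∘L JR ∘L (ContinuousLinearMap.mul ℝ EE Q)) :=
    (JR_compact.comp_clm (ContinuousLinearMap.mul ℝ EE Q)).clm_comp (ContinuousLinearMap.mul ℝ EE P)
  exact (h1.add h2).smul k

theorem JL_nonneg (f : EE) (hf : ∀ x, 0 ≤ f x) (x) : 0 ≤ JL f x := by
  rw [JL_apply]; exact intervalIntegral.integral_nonneg x.2.1 fun t _ => hf _

theorem JR_nonneg (f : EE) (hf : ∀ x, 0 ≤ f x) (x) : 0 ≤ JR f x := by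
  rw [JR_apply]; exact intervalIntegral.integral_nonneg x.2.2 fun t _ => hf _

theorem TT_ge (r : EE) (c α : ℝ) (hr : ∀ x, 0 ≤ r x) (hc : 0 ≤ c) (hα : 0 ≤ α) (u : EE)
    (hu : ∀ x, 0 ≤ u x) (x) : u x ≤ TT r c α u x := by
  rw [TT_apply]
  have h1 := JL_nonneg u hu 1
  have h2 := JR_nonneg (r * JL u) (fun x => mul_nonneg (hr x) (JL_nonneg u hu x)) x
  nlinarith [mul_nonneg hα h1, mul_nonneg hc h2]

theorem GG_upper (P Q : EE) (k : ℝ) (hk : 0 ≤ k) (hP : Monotone P) (hQ : Antitone Q)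
    (hP0 : ∀ x, 0 ≤ P x) (hQ0 : ∀ x, 0 ≤ Q x) (f : EE) (hf : ∀ x, 0 ≤ f x) :
    ∃ C, 0 < C ∧ ∀ x, GG P Q k f x ≤ C * (P x * Q x) := by
  refine ⟨k * JL f 1 + 1, by have := mul_nonneg hk (JL_nonneg f hf 1); linarith, fun x => ?_⟩
  rw [GG_apply]
  have h1 : JL (P * f) x ≤ P x * JL f x := by
    rw [JL_apply, JL_apply, ← intervalIntegral.integral_const_mul]
    refine intervalIntegral.integral_mono_on x.2.1 (ev_ii _ _ _) ((ev_ii _ _ _).const_mul _) fun t ht => ?_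
    refine mul_le_mul_of_nonneg_right (hP ?_) (hf _)
    have := monotone_projIcc (zero_le_one' ℝ) ht.2
    rwa [projIcc_val] at this
  have h2 : JR (Q * f) x ≤ Q x * JR f x := by
    rw [JR_apply, JR_apply, ← intervalIntegral.integral_const_mul]
    refine intervalIntegral.integral_mono_on x.2.2 (ev_ii _ _ _) ((ev_ii _ _ _).const_mul _) fun t ht => ?_
    refine mul_le_mul_of_nonneg_right (hQ ?_) (hf _)
    have := monotone_projIcc (zero_le_one' ℝ) ht.1
    rwa [projIcc_val] at this
  have h3 : JR f x = JL f 1 - JL f x := rfl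
  have h4 : Q x * JL (P * f) x + P x * JR (Q * f) x ≤ P x * Q x * JL f 1 := by
    rw [h3] at h2
    have a1 := mul_le_mul_of_nonneg_left h1 (hQ0 x)
    have a2 := mul_le_mul_of_nonneg_left h2 (hP0 x)
    nlinarith
  have h5 := mul_le_mul_of_nonneg_left h4 hk
  nlinarith [mul_nonneg (hP0 x) (hQ0 x)]

theorem JL_pos (f : EE) (hf : ∀ x, 0 ≤ f x) (x0 : Icc (0:ℝ) 1) (h0 : 0 < f x0) : 0 < JL f 1 := by
  rw [JL_apply]
  change 0 < ∫ t in (0:ℝ)..1, ev f t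
  refine intervalIntegral.integral_pos one_pos (ev_cont f).continuousOn (fun t _ => hf _)
    ⟨x0, x0.2, by rwa [ev_coe]⟩

theorem GG_lower (P Q : EE) (k s : ℝ) (hk : 0 < k) (hs : 0 < s)
    (hP0 : ∀ x, 0 ≤ P x) (hQ0 : ∀ x, 0 ≤ Q x) (hPs : ∀ x, P x ≤ s) (hQs : ∀ x, Q x ≤ s)
    (hP1 : ∀ x : Icc (0:ℝ) 1, 0 < (x:ℝ) → 0 < P x) (hQ1 : ∀ x : Icc (0:ℝ) 1, (x:ℝ) < 1 → 0 < Q x)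
    (f : EE) (hf : ∀ x, 0 ≤ f x) (hf0 : f ≠ 0) :
    ∃ ε, 0 < ε ∧ ∀ x, ε * (P x * Q x) ≤ GG P Q k f x := by
  have hI : 0 < JL (P * Q * f) 1 := by
    have : ∃ x : Icc (0:ℝ) 1, 0 < (x:ℝ) ∧ (x:ℝ) < 1 ∧ 0 < f x := by
      by_contra! hcon
      apply hf0
      have h1 : EqOn (ev f) 0 (Ioo 0 1) := by
        intro t ht
        have := hcon ⟨t, ht.1.le, ht.2.le⟩ ht.1 ht.2
        rw [ev_of_mem f t ⟨ht.1.le, ht.2.le⟩]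
        exact le_antisymm this (hf _)
      have h2 := h1.closure (ev_cont f) continuous_zero
      rw [closure_Ioo (by norm_num)] at h2
      ext x
      have := h2 x.2
      rwa [ev_coe] at this
    obtain ⟨x, hx0, hx1, hfx⟩ := this
    exact JL_pos _ (fun x => mul_nonneg (mul_nonneg (hP0 x) (hQ0 x)) (hf x)) x
      (mul_pos (mul_pos (hP1 x hx0) (hQ1 x hx1)) hfx)
  refine ⟨k * (JL (P * Q * f) 1 / s ^ 2), by positivity, fun x => ?_⟩
  rw [GG_apply, mul_assoc]
  refine mul_le_mul_of_nonneg_left ?_ hk.le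
  have h1 : JL (P * Q * f) x ≤ s * JL (P * f) x := by
    rw [JL_apply, JL_apply, ← intervalIntegral.integral_const_mul]
    refine intervalIntegral.integral_mono_on x.2.1 (ev_ii _ _ _) ((ev_ii _ _ _).const_mul _) fun t ht => ?_
    change P _ * Q _ * f _ ≤ s * (P _ * f _)
    nlinarith [mul_le_mul_of_nonneg_right (hQs (projIcc 0 1 zero_le_one t)) (mul_nonneg (hP0 (projIcc 0 1 zero_le_one t)) (hf (projIcc 0 1 zero_le_one t)))]
  have h2 : JR (P * Q * f) x ≤ s * JR (Q * f) x := by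
    rw [JR_apply, JR_apply, ← intervalIntegral.integral_const_mul]
    refine intervalIntegral.integral_mono_on x.2.2 (ev_ii _ _ _) ((ev_ii _ _ _).const_mul _) fun t ht => ?_
    change P _ * Q _ * f _ ≤ s * (Q _ * f _)
    nlinarith [mul_le_mul_of_nonneg_right (hPs (projIcc 0 1 zero_le_one t)) (mul_nonneg (hQ0 (projIcc 0 1 zero_le_one t)) (hf (projIcc 0 1 zero_le_one t)))]
  have h3 : JR (P * Q * f) x = JL (P * Q * f) 1 - JL (P * Q * f) x := rfl
  have h4 := JL_nonneg (P * f) (fun x => mul_nonneg (hP0 x) (hf x)) x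
  have h5 := JR_nonneg (Q * f) (fun x => mul_nonneg (hQ0 x) (hf x)) x
  have h6 : P x * Q x * (s * JL (P * f) x) ≤ s ^ 2 * (Q x * JL (P * f) x) := by
    nlinarith [mul_le_mul_of_nonneg_right (hPs x) (mul_nonneg hs.le (mul_nonneg (hQ0 x) h4))]
  have h7 : P x * Q x * (s * JR (Q * f) x) ≤ s ^ 2 * (P x * JR (Q * f) x) := by
    nlinarith [mul_le_mul_of_nonneg_right (hQs x) (mul_nonneg hs.le (mul_nonneg (hP0 x) h5))]
  rw [div_mul_eq_mul_div, div_le_iff₀ (by positivity)]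
  have h8 := mul_le_mul_of_nonneg_left (add_le_add h1 h2) (mul_nonneg (hP0 x) (hQ0 x))
  rw [h3] at h8
  nlinarith

theorem perron (P Q r : EE) (k s c α lam : ℝ) (hk : 0 < k) (hs : 0 < s)
    (hP : Monotone P) (hQ : Antitone Q)
    (hP0 : ∀ x, 0 ≤ P x) (hQ0 : ∀ x, 0 ≤ Q x) (hPs : ∀ x, P x ≤ s) (hQs : ∀ x, Q x ≤ s)
    (hP1 : ∀ x : Icc (0:ℝ) 1, 0 < (x:ℝ) → 0 < P x) (hQ1 : ∀ x : Icc (0:ℝ) 1, (x:ℝ) < 1 → 0 < Q x)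
    (hr : ∀ x, 0 ≤ r x) (hc : 0 ≤ c) (hα : 0 ≤ α) (hlam : 0 < lam)
    (hno : ∀ mu, 0 < mu → mu < lam → ∀ u : EE, u = mu • GG P Q k (TT r c α u) → u = 0)
    (u : EE) (hu0 : u ≠ 0) (hu : u = lam • GG P Q k (TT r c α u)) :
    ∀ x : Icc (0:ℝ) 1, 0 < (x:ℝ) → (x:ℝ) < 1 → u x ≠ 0 := by
  let A : EE →L[ℝ] EE := (GG P Q k) ∘L (TT r c α)
  have hAa : ∀ f, A f = GG P Q k (TT r c α f) := fun f => rfl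
  have hAc : IsCompactOperator A := (GG_compact P Q k).comp_clm (TT r c α)
  have hTpos : ∀ f : EE, (∀ x, 0 ≤ f x) → ∀ x, 0 ≤ TT r c α f x := fun f hf x =>
    (hf x).trans (TT_ge r c α hr hc hα f hf x)
  have hGpos : ∀ f : EE, (∀ x, 0 ≤ f x) → ∀ x, 0 ≤ GG P Q k f x := by
    intro f hf x
    rw [GG_apply]
    have h4 := JL_nonneg (P * f) (fun x => mul_nonneg (hP0 x) (hf x)) x
    have h5 := JR_nonneg (Q * f) (fun x => mul_nonneg (hQ0 x) (hf x)) x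
    have := hP0 x
    have := hQ0 x
    positivity
  have hApos : ∀ f : EE, (∀ x, 0 ≤ f x) → ∀ x, 0 ≤ A f x := fun f hf => hGpos _ (hTpos f hf)
  have hTne : ∀ f : EE, (∀ x, 0 ≤ f x) → f ≠ 0 → TT r c α f ≠ 0 := by
    intro f hf hf0 h
    apply hf0
    ext x
    have := TT_ge r c α hr hc hα f hf x
    rw [h] at this
    exact le_antisymm this (hf x)
  let w : EE := ⟨fun x => |u x|, by fun_prop⟩
  have hw : ∀ x, w x = |u x| := fun x => rfl
  have hw0 : ∀ x, 0 ≤ w x := fun x => abs_nonneg _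
  have hwne : w ≠ 0 := by
    intro h
    apply hu0
    ext x
    have := congrArg (fun f : EE => f x) h
    exact abs_eq_zero.1 this
  have hwle : ∀ x, w x ≤ lam * A w x := by
    intro x
    have h1 := hApos (w - u) (fun x => sub_nonneg.2 (le_abs_self _)) x
    have h2 := hApos (w + u) (fun x => by
      change 0 ≤ |u x| + u x
      linarith [neg_abs_le (u x)]) x
    rw [map_sub] at h1
    rw [map_add] at h2
    have h3 : u x = lam * A u x := congrArg (fun f : EE => f x) hu
    change 0 ≤ A w x - A u x at h1
    change 0 ≤ A w x + A u x at h2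
    rw [hw, abs_le]
    constructor <;> nlinarith
  let g : EE := lam • A w - w
  have hg : ∀ x, g x = lam * A w x - w x := fun x => rfl
  have hg0 : ∀ x, 0 ≤ g x := fun x => by rw [hg]; linarith [hwle x]
  have hgz : g = 0 := by
    by_contra hgne
    obtain ⟨ε, hε, h1⟩ := GG_lower P Q k s hk hs hP0 hQ0 hPs hQs hP1 hQ1 _ (hTpos g hg0)
      (hTne g hg0 hgne)
    obtain ⟨C, hC, h2⟩ := GG_upper P Q k hk.le hP hQ hP0 hQ0 _ (hTpos w hw0)
    have hAg : ∀ x, A g x = lam * A (A w) x - A w x := by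
      intro x
      have : A g = lam • A (A w) - A w := by
        change A (lam • A w - w) = _
        rw [map_sub, map_smul]
      rw [this]; rfl
    have hd : 0 < ε / C := div_pos hε hC
    have h3 : ∀ x, A w x ≤ (lam / (1 + ε / C)) * A (A w) x := by
      intro x
      have h4 : ε * (P x * Q x) ≤ lam * A (A w) x - A w x := by
        rw [← hAg]; exact h1 x
      have h5 : A w x ≤ C * (P x * Q x) := h2 x
      rw [div_mul_eq_mul_div, le_div_iff₀ (by positivity)]
      have h6 : ε / C * A w x ≤ ε / C * (C * (P x * Q x)) := mul_le_mul_of_nonneg_left h5 hd.le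
      have h7 : ε / C * (C * (P x * Q x)) = ε * (P x * Q x) := by field_simp
      nlinarith
    have hlt : lam / (1 + ε / C) < lam := div_lt_self hlam (by linarith)
    have h8 := abs_key A hAc hApos (lam / (1 + ε / C)) (by positivity) (by
      intro mu hmu1 hmu2 f hf
      rcases hmu1.eq_or_lt with h | h
      · rw [hf, ← h, zero_smul]
      · exact hno mu h (by linarith) f hf) (A w) h3
    apply hwne
    ext x
    refine le_antisymm ?_ (hw0 x)
    have := hwle x
    change w x ≤ 0
    nlinarith [h8 x]
  intro x hx0 hx1 hux
  obtain ⟨ε, hε, h1⟩ := GG_lower P Q k s hk hs hP0 hQ0 hPs hQs hP1 hQ1 _ (hTpos w hw0)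
      (hTne w hw0 hwne)
  have h2 : 0 < A w x :=
    lt_of_lt_of_le (mul_pos hε (mul_pos (hP1 x hx0) (hQ1 x hx1))) (h1 x)
  have h3 := hg x
  rw [hgz, hw, hux, abs_zero] at h3
  have h4 : (0:ℝ) = lam * A w x - 0 := h3
  have := mul_pos hlam h2
  linarith

noncomputable def FL (f : EE) (x : ℝ) : ℝ := ∫ t in (0:ℝ)..x, ev f t
noncomputable def FR (f : EE) (x : ℝ) : ℝ := ∫ t in x..(1:ℝ), ev f t

theorem FL_deriv (f : EE) (x : ℝ) : HasDerivAt (FL f) (ev f x) x :=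
  intervalIntegral.integral_hasDerivAt_right (ev_ii _ _ _)
    ((ev_cont f).stronglyMeasurableAtFilter _ _) (ev_cont f).continuousAt

theorem FR_deriv (f : EE) (x : ℝ) : HasDerivAt (FR f) (-ev f x) x :=
  intervalIntegral.integral_hasDerivAt_left (ev_ii _ _ _)
    ((ev_cont f).stronglyMeasurableAtFilter _ _) (ev_cont f).continuousAt

theorem ev_JL (f : EE) {x : ℝ} (hx : x ∈ Icc (0:ℝ) 1) : ev (JL f) x = FL f x := by
  rw [ev_of_mem _ _ hx, JL_apply]; rfl

theorem ev_JR (f : EE) {x : ℝ} (hx : x ∈ Icc (0:ℝ) 1) : ev (JR f) x = FR f x := by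
  rw [ev_of_mem _ _ hx, JR_apply]; rfl

theorem ev_GG (q f : EE) (k : ℝ) {x : ℝ} (hx : x ∈ Icc (0:ℝ) 1) :
    ev (GG (JL q) (JR q) k f) x = k * (FR q x * FL (JL q * f) x + FL q x * FR (JR q * f) x) := by
  rw [← ev_JL _ hx, ← ev_JR _ hx, ← ev_JL _ hx, ← ev_JR _ hx]; rfl

theorem ev_TT (r u : EE) (c α : ℝ) {x : ℝ} (hx : x ∈ Icc (0:ℝ) 1) :
    ev (TT r c α u) x = ev u x + α * FL u 1 + c * FR (r * JL u) x := by
  rw [← ev_JR _ hx]; rfl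

theorem FL_add_FR (q : EE) (x : ℝ) : FL q x + FR q x = FL q 1 :=
  intervalIntegral.integral_add_adjacent_intervals (ev_ii _ _ _) (ev_ii _ _ _)

theorem FL_zero (q : EE) : FL q 0 = 0 := intervalIntegral.integral_same
theorem FR_one (q : EE) : FR q 1 = 0 := intervalIntegral.integral_same

theorem GG_props (q f : EE) (k : ℝ) (hk : k * FL q 1 = 1) :
    ∃ h : ℝ → ℝ, (∀ x ∈ Icc (0:ℝ) 1,
      HasDerivWithinAt (ev (GG (JL q) (JR q) k f)) (ev q x * h x) (Icc 0 1) x) ∧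
      (∀ x ∈ Icc (0:ℝ) 1, HasDerivWithinAt h (-ev f x) (Icc 0 1) x) ∧
      ev (GG (JL q) (JR q) k f) 0 = 0 ∧ ev (GG (JL q) (JR q) k f) 1 = 0 := by
  refine ⟨fun x => k * (-FL (JL q * f) x + FR (JR q * f) x), ?_, ?_, ?_, ?_⟩
  · intro x hx
    have h1 := (((FR_deriv q x).mul (FL_deriv (JL q * f) x)).add
      ((FL_deriv q x).mul (FR_deriv (JR q * f) x))).const_mul k
    have h2 := (h1.hasDerivWithinAt (s := Icc 0 1)).congr_of_mem
      (f₁ := ev (GG (JL q) (JR q) k f)) (fun y hy => ev_GG q f k hy) hx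
    refine h2.congr_deriv ?_
    have e1 : ev (JL q * f) x = FL q x * ev f x := by rw [← ev_JL _ hx]; rfl
    have e2 : ev (JR q * f) x = FR q x * ev f x := by rw [← ev_JR _ hx]; rfl
    rw [e1, e2]; ring
  · intro x hx
    have h1 := ((FL_deriv (JL q * f) x).neg.add (FR_deriv (JR q * f) x)).const_mul k
    refine h1.hasDerivWithinAt.congr_deriv ?_
    have e1 : ev (JL q * f) x = FL q x * ev f x := by rw [← ev_JL _ hx]; rfl
    have e2 : ev (JR q * f) x = FR q x * ev f x := by rw [← ev_JR _ hx]; rfl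
    rw [e1, e2]
    have := FL_add_FR q x
    have h3 : FR q x = FL q 1 - FL q x := by linarith
    rw [h3]
    linear_combination (-ev f x) * hk
  · rw [ev_GG q f k (by simp), FL_zero, FL_zero]; ring
  · rw [ev_GG q f k (by simp), FR_one, FR_one]; ring

theorem TT_deriv (r u : EE) (c α : ℝ) (u1 : ℝ) {x : ℝ} (hx : x ∈ Icc (0:ℝ) 1)
    (hu : HasDerivWithinAt (ev u) u1 (Icc 0 1) x) :
    HasDerivWithinAt (ev (TT r c α u)) (u1 - c * (ev r x * FL u x)) (Icc 0 1) x := by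
  have h1 := (hu.add_const (α * FL u 1)).add
    ((FR_deriv (r * JL u) x).hasDerivWithinAt (s := Icc 0 1) |>.const_mul c)
  have h2 := h1.congr_of_mem (f₁ := ev (TT r c α u)) (fun y hy => ev_TT r u c α hy) hx
  refine h2.congr_deriv ?_
  have e1 : ev (r * JL u) x = ev r x * FL u x := by rw [← ev_JL _ hx]; rfl
  rw [e1]; ring

theorem Dv_eq {y : ℝ → ℝ} {d : ℝ} {x : ℝ} (hx : x ∈ Icc (0:ℝ) 1)
    (h : HasDerivWithinAt y d (Icc 0 1) x) : Dv y x = d :=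
  h.derivWithin (uniqueDiffOn_Icc one_pos x hx)

theorem cd2 {y y1 y2 : ℝ → ℝ} (h1 : ∀ x ∈ Icc (0:ℝ) 1, HasDerivWithinAt y (y1 x) (Icc 0 1) x)
    (h2 : ∀ x ∈ Icc (0:ℝ) 1, HasDerivWithinAt y1 (y2 x) (Icc 0 1) x)
    (h3 : ContinuousOn y2 (Icc 0 1)) : ContDiffOn ℝ 2 y (Icc 0 1) := by
  have hu := uniqueDiffOn_Icc (zero_lt_one' ℝ)
  have hy1 : ContDiffOn ℝ 1 y1 (Icc 0 1) := by
    rw [show (1 : WithTop ℕ∞) = 0 + 1 from rfl, contDiffOn_succ_iff_derivWithin hu]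
    refine ⟨fun x hx => (h2 x hx).differentiableWithinAt, by simp, ?_⟩
    rw [contDiffOn_zero]
    exact h3.congr fun x hx => Dv_eq hx (h2 x hx)
  rw [show (2 : WithTop ℕ∞) = 1 + 1 from rfl, contDiffOn_succ_iff_derivWithin hu]
  refine ⟨fun x hx => (h1 x hx).differentiableWithinAt, by simp, ?_⟩
  exact hy1.congr fun x hx => Dv_eq hx (h1 x hx)

theorem cd2_inv {y : ℝ → ℝ} (h : ContDiffOn ℝ 2 y (Icc 0 1)) :
    (∀ x ∈ Icc (0:ℝ) 1, HasDerivWithinAt y (Dv y x) (Icc 0 1) x) ∧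
    (∀ x ∈ Icc (0:ℝ) 1, HasDerivWithinAt (Dv y) (Dv (Dv y) x) (Icc 0 1) x) := by
  have hu := uniqueDiffOn_Icc (zero_lt_one' ℝ)
  have h1 : ContDiffOn ℝ 1 (Dv y) (Icc 0 1) := by
    rw [show (2 : WithTop ℕ∞) = 1 + 1 from rfl, contDiffOn_succ_iff_derivWithin hu] at h
    exact h.2.2
  exact ⟨fun x hx => (h.differentiableOn (by norm_num) x hx).hasDerivWithinAt,
    fun x hx => (h1.differentiableOn (by norm_num) x hx).hasDerivWithinAt⟩

theorem const01 {F : ℝ → ℝ} (h : ∀ x ∈ Icc (0:ℝ) 1, HasDerivWithinAt F 0 (Icc 0 1) x) :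
    ∀ x ∈ Icc (0:ℝ) 1, F x = F 0 :=
  constant_of_derivWithin_zero (fun x hx => (h x hx).differentiableWithinAt)
    fun x hx => Dv_eq ⟨hx.1, hx.2.le⟩ (h x ⟨hx.1, hx.2.le⟩)

theorem converse (p r : ℝ → ℝ) (q rE : EE) (c α mu k : ℝ)
    (hpq : ∀ x ∈ Icc (0:ℝ) 1, p x * ev q x = 1) (hr : ∀ x ∈ Icc (0:ℝ) 1, ev rE x = r x)
    (hk : k * FL q 1 = 1) (u : EE) (hu : u = mu • GG (JL q) (JR q) k (TT rE c α u)) :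
    SolT p r c mu (FL u) ∧ BC2 p mu α (FL u) := by
  obtain ⟨h, hG, hh, hG0, hG1⟩ := GG_props q (TT rE c α u) k hk
  set f := TT rE c α u with hf
  have hev : ∀ x, ev u x = mu * ev (GG (JL q) (JR q) k f) x := fun x =>
    congrArg (fun v : EE => ev v x) hu
  have d1 : ∀ x ∈ Icc (0:ℝ) 1, HasDerivWithinAt (FL u) (ev u x) (Icc 0 1) x := fun x _ =>
    (FL_deriv u x).hasDerivWithinAt
  have d2 : ∀ x ∈ Icc (0:ℝ) 1, HasDerivWithinAt (ev u) (mu * (ev q x * h x)) (Icc 0 1) x := by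
    intro x hx
    exact ((hG x hx).const_mul mu).congr_of_mem (fun y _ => hev y) hx
  have d3 : ∀ x ∈ Icc (0:ℝ) 1, HasDerivWithinAt (fun t => mu * h t) (mu * -ev f x) (Icc 0 1) x :=
    fun x hx => (hh x hx).const_mul mu
  have d4 : ∀ x ∈ Icc (0:ℝ) 1, HasDerivWithinAt (fun t => mu * -ev f t)
      (mu * -(mu * (ev q x * h x) - c * (r x * FL u x))) (Icc 0 1) x := by
    intro x hx
    have := ((TT_deriv rE u c α _ hx (d2 x hx)).neg).const_mul mu
    rw [hr x hx] at this
    exact this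
  have e1 : ∀ x ∈ Icc (0:ℝ) 1, Dv (FL u) x = ev u x := fun x hx => Dv_eq hx (d1 x hx)
  have e2 : ∀ x ∈ Icc (0:ℝ) 1, Dv (Dv (FL u)) x = mu * (ev q x * h x) := fun x hx =>
    Dv_eq hx ((d2 x hx).congr_of_mem e1 hx)
  have e3 : ∀ x ∈ Icc (0:ℝ) 1, p x * Dv (Dv (FL u)) x = mu * h x := by
    intro x hx
    rw [e2 x hx]
    linear_combination mu * h x * hpq x hx
  have e4 : ∀ x ∈ Icc (0:ℝ) 1, Dv (fun t => p t * Dv (Dv (FL u)) t) x = mu * -ev f x := fun x hx =>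
    Dv_eq hx ((d3 x hx).congr_of_mem e3 hx)
  have e5 : ∀ x ∈ Icc (0:ℝ) 1, Dv (Dv (fun t => p t * Dv (Dv (FL u)) t)) x =
      mu * -(mu * (ev q x * h x) - c * (r x * FL u x)) := fun x hx =>
    Dv_eq hx ((d4 x hx).congr_of_mem e4 hx)
  have hhc : ContinuousOn h (Icc 0 1) := fun x hx => (hh x hx).continuousWithinAt
  have hFc : ContinuousOn (FL u) (Icc 0 1) := fun x hx => (d1 x hx).continuousWithinAt
  have hrc : ContinuousOn r (Icc 0 1) := (ev_cont rE).continuousOn.congr fun x hx => (hr x hx).symm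
  have hqc : ContinuousOn (ev q) (Icc 0 1) := (ev_cont q).continuousOn
  have m0 : (0:ℝ) ∈ Icc (0:ℝ) 1 := by simp
  have m1 : (1:ℝ) ∈ Icc (0:ℝ) 1 := by simp
  refine ⟨⟨cd2 d1 d2 (by fun_prop), ?_, ?_⟩, FL_zero u, ?_, ?_, ?_⟩
  · exact (cd2 d3 d4 (by fun_prop)).congr e3
  · intro x hx
    rw [e5 x hx, e2 x hx]; ring
  · rw [e1 0 m0, hev, hG0, mul_zero]
  · rw [e1 1 m1, hev, hG1, mul_zero]
  · rw [e4 1 m1, hf, ev_TT rE u c α m1, FR_one, hev 1, hG1]; ring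

theorem forward (p r : ℝ → ℝ) (q rE : EE) (c α lam k : ℝ)
    (hpq : ∀ x ∈ Icc (0:ℝ) 1, p x * ev q x = 1) (hr : ∀ x ∈ Icc (0:ℝ) 1, ev rE x = r x)
    (hk : k * FL q 1 = 1) (y : ℝ → ℝ) (hy : SolT p r c lam y) (hb : BC2 p lam α y) :
    ∃ u : EE, (∀ x ∈ Icc (0:ℝ) 1, y x = FL u x) ∧
      u = lam • GG (JL q) (JR q) k (TT rE c α u) := by
  obtain ⟨hy1, hy2, hy3⟩ := hy
  obtain ⟨b1, b2, b3, b4⟩ := hb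
  obtain ⟨d1, d2⟩ := cd2_inv hy1
  obtain ⟨d3, d4⟩ := cd2_inv hy2
  set w := fun x => p x * Dv (Dv y) x with hw
  have hc : ContinuousOn (Dv y) (Icc 0 1) := fun x hx => (d2 x hx).continuousWithinAt
  let u : EE := ⟨(Icc (0:ℝ) 1).domRestrict (Dv y), hc.domRestrict⟩
  have hu : ∀ x ∈ Icc (0:ℝ) 1, ev u x = Dv y x := fun x hx => ev_of_mem u x hx
  have m0 : (0:ℝ) ∈ Icc (0:ℝ) 1 := by simp
  have m1 : (1:ℝ) ∈ Icc (0:ℝ) 1 := by simp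
  have hyF : ∀ x ∈ Icc (0:ℝ) 1, y x = FL u x := by
    intro x hx
    have := const01 (F := fun x => y x - FL u x) (fun x hx => by
      refine ((d1 x hx).sub (FL_deriv u x).hasDerivWithinAt).congr_deriv ?_
      rw [hu x hx, sub_self]) x hx
    simp only [b1, FL_zero] at this
    linarith
  refine ⟨u, hyF, ?_⟩
  obtain ⟨h, hG, hh, hG0, hG1⟩ := GG_props q (TT rE c α u) k hk
  set f := TT rE c α u with hf
  have s1 : ∀ x ∈ Icc (0:ℝ) 1, Dv w x = -lam * ev f x := by
    have key := const01 (F := fun x => Dv w x + lam * ev f x) (fun x hx => by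
      have du : HasDerivWithinAt (ev u) (Dv (Dv y) x) (Icc 0 1) x := (d2 x hx).congr_of_mem hu hx
      refine ((d4 x hx).add ((TT_deriv rE u c α _ hx du).const_mul lam)).congr_deriv ?_
      rw [hr x hx, ← hyF x hx]
      linear_combination hy3 x hx)
    have h1 := key 1 m1
    have h2 : Dv w 1 + lam * ev f 1 = 0 := by
      rw [hf, ev_TT rE u c α m1, FR_one, hu 1 m1, b3, ← hyF 1 m1]
      linear_combination b4
    intro x hx
    have h3 := key x hx
    linarith
  have s2 : ∀ x ∈ Icc (0:ℝ) 1, w x - lam * h x = w 0 - lam * h 0 :=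
    const01 (F := fun x => w x - lam * h x) (fun x hx => by
      refine ((d3 x hx).sub ((hh x hx).const_mul lam)).congr_deriv ?_
      rw [s1 x hx]; ring)
  set κ := w 0 - lam * h 0 with hκ
  have s3 := const01 (F := fun x => ev u x - lam * ev (GG (JL q) (JR q) k f) x - κ * FL q x)
    (fun x hx => by
      have du : HasDerivWithinAt (ev u) (Dv (Dv y) x) (Icc 0 1) x := (d2 x hx).congr_of_mem hu hx
      refine ((du.sub ((hG x hx).const_mul lam)).sub
        ((FL_deriv q x).hasDerivWithinAt.const_mul κ)).congr_deriv ?_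
      have h1 := s2 x hx
      simp only [hw] at h1
      have h2 := hpq x hx
      linear_combination (-Dv (Dv y) x) * h2 + ev q x * h1)
  simp only [hu 0 m0, b2, hG0, FL_zero] at s3
  have s4 := s3 1 m1
  rw [hu 1 m1, b3, hG1] at s4
  have hq1 : FL q 1 ≠ 0 := fun h => by rw [h] at hk; simp at hk
  have hκ0 : κ = 0 := by
    have : κ * FL q 1 = 0 := by linarith
    exact (mul_eq_zero.1 this).resolve_right hq1
  ext x
  have s5 := s3 x x.2
  rw [hκ0, ev_coe, ev_coe] at s5
  change u x = lam * GG (JL q) (JR q) k f x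
  linarith

theorem stmt_17 (p r : ℝ → ℝ) (c alpha lam : ℝ)
    (hpc : ContinuousOn p (Icc 0 1)) (hrc : ContinuousOn r (Icc 0 1))
    (hp : ∀ x ∈ Icc (0:ℝ) 1, 0 < p x) (hr : ∀ x ∈ Icc (0:ℝ) 1, 0 < r x)
    (hc : 0 < c) (halpha : 0 ≤ alpha) (hlam : 0 < lam)
    (heig : EigT2 p r c alpha lam)
    (hfirst : ∀ μ : ℝ, 0 < μ → μ < lam → ¬ EigT2 p r c alpha μ) :
    (∀ y₁ y₂ : ℝ → ℝ, SolT p r c lam y₁ → Nontriv y₁ → BC2 p lam alpha y₁ →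
      SolT p r c lam y₂ → Nontriv y₂ → BC2 p lam alpha y₂ → LinDep y₁ y₂) ∧
    (∀ y : ℝ → ℝ, SolT p r c lam y → Nontriv y → BC2 p lam alpha y →
      ∀ x ∈ Ioo (0:ℝ) 1, y x ≠ 0) := by
  let q : EE := ⟨(Icc (0:ℝ) 1).domRestrict (fun x => (p x)⁻¹),
    (hpc.inv₀ fun x hx => (hp x hx).ne').domRestrict⟩
  let rE : EE := ⟨(Icc (0:ℝ) 1).domRestrict r, hrc.domRestrict⟩
  have hq : ∀ x ∈ Icc (0:ℝ) 1, ev q x = (p x)⁻¹ := fun x hx => ev_of_mem q x hx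
  have hpq : ∀ x ∈ Icc (0:ℝ) 1, p x * ev q x = 1 := fun x hx => by
    rw [hq x hx, mul_inv_cancel₀ (hp x hx).ne']
  have hrE : ∀ x ∈ Icc (0:ℝ) 1, ev rE x = r x := fun x hx => ev_of_mem rE x hx
  have hqpos : ∀ t, 0 < ev q t := fun t =>
    inv_pos.2 (hp _ (projIcc 0 1 zero_le_one t).2)
  have hint : ∀ a b : ℝ, a < b → 0 < ∫ t in a..b, ev q t := fun a b hab =>
    intervalIntegral.intervalIntegral_pos_of_pos (ev_ii _ _ _) hqpos hab
  have hs : 0 < FL q 1 := hint 0 1 one_pos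
  have hk : (FL q 1)⁻¹ * FL q 1 = 1 := inv_mul_cancel₀ hs.ne'
  set k := (FL q 1)⁻¹ with hkdef
  have hk0 : 0 < k := inv_pos.2 hs
  have hq0 : ∀ x, 0 ≤ q x := fun x => by
    have := hqpos x
    rw [ev_coe] at this
    exact this.le
  have hsum : ∀ x : Icc (0:ℝ) 1, JL q x + JR q x = FL q 1 := fun x => by
    rw [JL_apply, JR_apply]; exact FL_add_FR q x
  have hP0 := JL_nonneg q hq0
  have hQ0 := JR_nonneg q hq0
  have hmono : Monotone (JL q) := by
    intro a b hab
    have h1 : JL q b - JL q a = ∫ t in (a:ℝ)..b, ev q t := by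
      rw [JL_apply, JL_apply, intervalIntegral.integral_interval_sub_left (ev_ii _ _ _) (ev_ii _ _ _)]
    have h2 : 0 ≤ ∫ t in (a:ℝ)..b, ev q t :=
      intervalIntegral.integral_nonneg hab fun t _ => (hqpos t).le
    linarith
  have hanti : Antitone (JR q) := by
    intro a b hab
    have := hmono hab
    linarith [hsum a, hsum b]
  have hno : ∀ mu, 0 < mu → mu < lam → ∀ u : EE,
      u = mu • GG (JL q) (JR q) k (TT rE c alpha u) → u = 0 := by
    intro mu h0 h1 u hu
    by_contra hne
    apply hfirst mu h0 h1
    obtain ⟨a1, a2⟩ := converse p r q rE c alpha mu k hpq hrE hk u hu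
    refine ⟨FL u, a1, ?_, a2⟩
    by_contra hcon
    have hz : ∀ x ∈ Icc (0:ℝ) 1, FL u x = 0 := by
      intro x hx
      by_contra h
      exact hcon ⟨x, hx, h⟩
    apply hne
    ext x
    have h2 := (FL_deriv u x).hasDerivWithinAt (s := Icc 0 1)
    have h3 := (hasDerivWithinAt_const (x:ℝ) (Icc (0:ℝ) 1) (0:ℝ)).congr_of_mem hz x.2
    have h4 := (Dv_eq x.2 h2).symm.trans (Dv_eq x.2 h3)
    rwa [ev_coe] at h4
  have main : ∀ u : EE, u ≠ 0 → u = lam • GG (JL q) (JR q) k (TT rE c alpha u) →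
      ∀ x ∈ Ioc (0:ℝ) 1, FL u x ≠ 0 := by
    intro u hu0 hu x hx hFx
    have hne := perron (JL q) (JR q) rE k (FL q 1) c alpha lam hk0 hs hmono hanti hP0 hQ0
      (fun x => by linarith [hsum x, hQ0 x]) (fun x => by linarith [hsum x, hP0 x])
      (fun x hx => hint 0 x hx) (fun x hx => by rw [JR_apply]; exact hint x 1 hx)
      (fun x => (hr x x.2).le) hc.le halpha hlam hno u hu0 hu
    obtain ⟨ξ, hξ, hz⟩ := exists_hasDerivAt_eq_zero (f := FL u) (f' := ev u) hx.1
      (fun t _ => (FL_deriv u t).continuousAt.continuousWithinAt) (by rw [FL_zero, hFx])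
      (fun t _ => FL_deriv u t)
    have hξ1 : ξ < 1 := hξ.2.trans_le hx.2
    rw [ev_of_mem u ξ ⟨hξ.1.le, hξ1.le⟩] at hz
    exact hne ⟨ξ, hξ.1.le, hξ1.le⟩ hξ.1 hξ1 hz
  have fwd := forward p r q rE c alpha lam k hpq hrE hk
  have FLz : ∀ x, FL 0 x = 0 := fun x => by
    change ∫ t in (0:ℝ)..x, (0:ℝ) = 0
    simp
  have hnz : ∀ (y : ℝ → ℝ) (u : EE), Nontriv y → (∀ x ∈ Icc (0:ℝ) 1, y x = FL u x) → u ≠ 0 := by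
    rintro y u ⟨x, hx, hyx⟩ h rfl
    exact hyx (by rw [h x hx, FLz])
  have m1 : (1:ℝ) ∈ Icc (0:ℝ) 1 := by simp
  constructor
  · intro y₁ y₂ hy1 hn1 hb1 hy2 hn2 hb2
    obtain ⟨u1, hu1, he1⟩ := fwd y₁ hy1 hb1
    obtain ⟨u2, hu2, he2⟩ := fwd y₂ hy2 hb2
    have k1 := main u1 (hnz _ _ hn1 hu1) he1 1 ⟨one_pos, le_rfl⟩
    have hFL : ∀ (a b : ℝ) (x : ℝ), FL (a • u1 + b • u2) x = a * FL u1 x + b * FL u2 x := by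
      intro a b x
      unfold FL
      rw [← intervalIntegral.integral_const_mul, ← intervalIntegral.integral_const_mul,
        ← intervalIntegral.integral_add ((ev_ii _ _ _).const_mul _) ((ev_ii _ _ _).const_mul _)]
      rfl
    refine ⟨FL u2 1, -FL u1 1, Or.inr (neg_ne_zero.2 k1), ?_⟩
    have hz : FL u2 1 • u1 + (-FL u1 1) • u2 = 0 := by
      by_contra hne
      refine main _ hne ?_ 1 ⟨one_pos, le_rfl⟩ ?_
      · have g1 : ∀ v : EE, lam • GG (JL q) (JR q) k (TT rE c alpha v)
            = (lam • ((GG (JL q) (JR q) k) ∘L (TT rE c alpha))) v := fun v => rfl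
        rw [g1] at he1 he2 ⊢
        rw [map_add, map_smul, map_smul, ← he1, ← he2]
      · rw [hFL]; ring
    intro x hx
    rw [hu1 x hx, hu2 x hx, ← hFL, hz, FLz]
  · intro y hy hn hb x hx
    obtain ⟨u, hu, he⟩ := fwd y hy hb
    rw [hu x ⟨hx.1.le, hx.2.le⟩]
    exact main u (hnz _ _ hn hu) he x ⟨hx.1, hx.2.le⟩
end
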